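/- Let $(M,g)$ be a smooth Riemannian manifold of dimension $n\ge 3$ with Levi-Civita connection $\nabla$ and curvature tensor $R(X,Y)Z=\nabla_X\nabla_YZ-\nabla_Y\nabla_XZ-\nabla_{[X,Y]}Z$; let $\nabla_WR$ denote the covariant derivative of $R$. For a vector field $X=X^i\frac{\partial}{\partial x^i}$ on $M$ let $X^v=X^i\frac{\partial}{\partial y^i}$ and $X^h=X^i\bigl(\frac{\partial}{\partial x^i}-y^a\Gamma^j_{ai}\frac{\partial}{\partial y^j}\bigr)$ be its vertical and horizontal lifts to $TM$ (in the coordinates $(x^i,y^i)$ of $TM$ induced by coordinates $(x^i)$ of $M$, with $\Gamma^j_{ai}$ the Christoffel symbols of $\nabla$); for a point $(x,y)\in TM$ the same formulas define the lifts $u^h,u^v\in T_{(x,y)}TM$ of a vector $u\in T_xM$. Let $a,b,c\in\mathbb R$ with $a>0$ and $\alpha:=a(a+c)-b^2>0$, and let $G=a g^s+b g^h+c g^v$ be the Riemannian metric on $TM$ determined by $$G(X^h,Y^h)=(a+c)\,g(X,Y),\qquad G(X^h,Y^v)=G(X^v,Y^h)=b\,g(X,Y),\qquad G(X^v,Y^v)=a\,g(X,Y).$$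 Let $\widetilde R$ be the curvature tensor of (the Levi-Civita connection of) $(TM,G)$, with the same sign convention. Then for all smooth vector fields $X,Y,Z$ on $M$ and every point $(x,t)\in TM$, $t\in T_xM$, one has at $(x,t)$, all tensors on the right being evaluated at $x$, $$\begin{aligned} \widetilde R(X^h,Y^v)Z^h={}&\Bigl\{-\tfrac{a^2}{2\alpha}(\nabla_XR)(Y,t)Z+\tfrac{a^3b}{4\alpha^2}\bigl[R(X,t)R(Y,t)Z-R(Y,t)R(Z,t)X-R(Y,t)R(X,t)Z\bigr]\\ &\quad+\tfrac{ab}{2\alpha}\bigl[R(X,Y)Z+R(Z,Y)X\bigr]\Bigr\}^h\\ &+\Bigl\{\tfrac{ab}{2\alpha}(\nabla_XR)(Y,t)Z-\tfrac{a^2b^2}{4\alpha^2}\bigl[R(X,t)R(Y,t)Z-R(Y,t)R(Z,t)X-R(Y,t)R(X,t)Z\bigr]\\ &\quad+\tfrac{a^2}{4\alpha}R(X,R(Y,t)Z)t-\tfrac{b^2}{\alpha}R(X,Y)Z+\tfrac{a(a+c)}{2\alpha}R(X,Z)Y\Bigr\}^v. \end{aligned}$$ -/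

import Mathlib

open Bundle FiberBundle Manifold VectorField
open scoped Manifold ContDiff Topology

noncomputable section

section Curvature

variable {E : Type*} [NormedAddCommGroup E] [NormedSpace ℝ E]
  {H : Type*} [TopologicalSpace H] {I : ModelWithCorners ℝ E H}
  {M : Type*} [TopologicalSpace M] [ChartedSpace H M]

/-- `∇` is the Levi-Civita connection of the family `g` of inner products on the tangent spaces:
it is torsion-free and `X g(Y,Z) = g(∇_X Y, Z) + g(Y, ∇_X Z)`.
(Mathlib writes `∇ Y x (X x)` for `(∇_X Y)(x)`.) -/
structure IsLeviCivita [IsManifold I 2 M] [FiniteDimensional ℝ E] [CompleteSpace E]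
    (g : ∀ x : M, TangentSpace I x → TangentSpace I x → ℝ)
    (cov : CovariantDerivative I E (TangentSpace I : M → Type _)) : Prop where
  torsion_eq_zero : cov.torsion = 0
  metric : ∀ (x : M) (X Y Z : ∀ x : M, TangentSpace I x),
    MDiffAt (T% X) x → MDiffAt (T% Y) x → MDiffAt (T% Z) x →
      d% (fun x' ↦ g x' (Y x') (Z x')) x (X x)
        = g x (cov Y x (X x)) (Z x) + g x (Y x) (cov Z x (X x))

variable [IsManifold I 1 M]

/-- The vector field `∇_X Y`. -/
def nablaField (cov : CovariantDerivative I E (TangentSpace I : M → Type _))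
    (X Y : ∀ x : M, TangentSpace I x) (x : M) : TangentSpace I x :=
  cov Y x (X x)

/-- The vector field `R(X,Y)Z = ∇_X ∇_Y Z − ∇_Y ∇_X Z − ∇_{[X,Y]} Z`. -/
def curvField (cov : CovariantDerivative I E (TangentSpace I : M → Type _))
    (X Y Z : ∀ x : M, TangentSpace I x) (x : M) : TangentSpace I x :=
  nablaField cov X (nablaField cov Y Z) x - nablaField cov Y (nablaField cov X Z) x
    - nablaField cov (mlieBracket I X Y) Z x

/-- The vector field
`(∇_W R)(X,Y)Z = ∇_W (R(X,Y)Z) − R(∇_W X,Y)Z − R(X,∇_W Y)Z − R(X,Y)∇_W Z`. -/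
def nablaCurvField (cov : CovariantDerivative I E (TangentSpace I : M → Type _))
    (W X Y Z : ∀ x : M, TangentSpace I x) (x : M) : TangentSpace I x :=
  nablaField cov W (curvField cov X Y Z) x - curvField cov (nablaField cov W X) Y Z x
    - curvField cov X (nablaField cov W Y) Z x - curvField cov X Y (nablaField cov W Z) x

/-- The value `R_x(u,v)w` of the curvature tensor on tangent vectors at `x`. The vectors are
extended to vector fields near `x` with constant components in the chart at `x`. -/
def curvAt (cov : CovariantDerivative I E (TangentSpace I : M → Type _)) {x : M}
    (u v w : TangentSpace I x) : TangentSpace I x :=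
  curvField cov (extend E u) (extend E v) (extend E w) x

/-- The value `(∇_z R)_x(u,v)w` of the tensor `∇R` on tangent vectors at `x`. The vectors are
extended to vector fields near `x` with constant components in the chart at `x`. -/
def nablaCurvAt (cov : CovariantDerivative I E (TangentSpace I : M → Type _)) {x : M}
    (z u v w : TangentSpace I x) : TangentSpace I x :=
  nablaCurvField cov (extend E z) (extend E u) (extend E v) (extend E w) x

end Curvature

section TangentBundle

/-- A tangent vector at `q`, regarded as a tangent vector at `p = q`. -/
def castTangent {E : Type*} [NormedAddCommGroup E] [NormedSpace ℝ E]
    {H : Type*} [TopologicalSpace H] {I : ModelWithCorners ℝ E H}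
    {M : Type*} [TopologicalSpace M] [ChartedSpace H M]
    {q p : M} (h : q = p) (ξ : TangentSpace I q) : TangentSpace I p :=
  h ▸ ξ

variable {E : Type*} [NormedAddCommGroup E] [NormedSpace ℝ E]
  {H : Type*} [TopologicalSpace H] {I : ModelWithCorners ℝ E H}
  {M : Type*} [TopologicalSpace M] [ChartedSpace H M] [IsManifold I 1 M]

/-- The vertical lift of `w ∈ T_x M` to the point `p = (x,y)` of `TM`: the velocity at `s = 0` of
the curve `s ↦ (x, y + s w)`. -/
def vlift (p : TangentBundle I M) (w : TangentSpace I p.proj) : TangentSpace I.tangent p :=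
  castTangent (by simp) (mfderiv 𝓘(ℝ, ℝ) I.tangent
    (fun s : ℝ ↦ (⟨p.proj, p.snd + s • w⟩ : TangentBundle I M)) 0 (1 : ℝ))

/-- The horizontal lift of `u ∈ T_x M` to the point `p = (x,y)` of `TM`: it is
`dT(u) − (∇_u T)ᵛ`, where the vector field `T` with `T(x) = y` has constant components in the
chart at `x`. In coordinates this is `uⁱ (∂/∂xⁱ − yᵃ Γʲ_{ai} ∂/∂yʲ)`. -/
def hlift (cov : CovariantDerivative I E (TangentSpace I : M → Type _))
    (p : TangentBundle I M) (u : TangentSpace I p.proj) : TangentSpace I.tangent p :=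
  castTangent (by simp) (mfderiv I I.tangent
      (fun x ↦ (⟨x, extend E p.snd x⟩ : TangentBundle I M)) p.proj u)
    - vlift p (cov (extend E p.snd) p.proj u)

/-- The differential at `p = (x,y)` of the projection `π : TM → M`. -/
def dproj (p : TangentBundle I M) (ξ : TangentSpace I.tangent p) : TangentSpace I p.proj :=
  mfderiv I.tangent I (fun q : TangentBundle I M ↦ q.proj) p ξ

/-- The connection map `K : T_p TM → T_x M` at `p = (x,y)`, given in the chart at `x` by
`K(ξ)ʲ = dyʲ(ξ) + Γʲ_{ai} yᵃ dxⁱ(ξ)`. It is the left inverse of the vertical lift whose kernel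
is the horizontal space. -/
def connMap (cov : CovariantDerivative I E (TangentSpace I : M → Type _))
    (p : TangentBundle I M) (ξ : TangentSpace I.tangent p) : TangentSpace I p.proj :=
  (trivializationAt E (TangentSpace I : M → Type _) p.proj).symm p.proj
      (d% (fun q : TangentBundle I M ↦
        (trivializationAt E (TangentSpace I : M → Type _) p.proj q).2) p ξ)
    + cov (extend E p.snd) p.proj (dproj p ξ)

/-- The `g`-natural metric `G = a gˢ + b gʰ + c gᵛ` on `TM`. As `dπ(Xʰ) = X`, `K(Xʰ) = 0`,
`dπ(Xᵛ) = 0` and `K(Xᵛ) = X`, it is the bilinear form with `G(Xʰ,Yʰ) = (a+c) g(X,Y)`,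
`G(Xʰ,Yᵛ) = G(Xᵛ,Yʰ) = b g(X,Y)` and `G(Xᵛ,Yᵛ) = a g(X,Y)`. -/
def gNat (a b c : ℝ) (g : ∀ x : M, TangentSpace I x → TangentSpace I x → ℝ)
    (cov : CovariantDerivative I E (TangentSpace I : M → Type _))
    (p : TangentBundle I M) (ξ η : TangentSpace I.tangent p) : ℝ :=
  (a + c) * g p.proj (dproj p ξ) (dproj p η)
    + b * (g p.proj (dproj p ξ) (connMap cov p η) + g p.proj (connMap cov p ξ) (dproj p η))
    + a * g p.proj (connMap cov p ξ) (connMap cov p η)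

/-- The horizontal lift `Xʰ` of a vector field. -/
def hliftField (cov : CovariantDerivative I E (TangentSpace I : M → Type _))
    (X : ∀ x : M, TangentSpace I x) (p : TangentBundle I M) : TangentSpace I.tangent p :=
  hlift cov p (X p.proj)

/-- The vertical lift `Xᵛ` of a vector field. -/
def vliftField (X : ∀ x : M, TangentSpace I x) (p : TangentBundle I M) :
    TangentSpace I.tangent p :=
  vlift p (X p.proj)

end TangentBundle

end

noncomputable section

set_option maxSynthPendingDepth 3

namespace LocalConnection

variable {E : Type*} [NormedAddCommGroup E] [NormedSpace ℝ E]

/-- The curvature tensor of the connection on an open subset of `E` with Christoffel symbols `Γ`. -/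
def curv (Γ : E → E →L[ℝ] E →L[ℝ] E) (z : E) : E →L[ℝ] E →L[ℝ] E →L[ℝ] E :=
  fderiv ℝ Γ z - (fderiv ℝ Γ z).flip
    + (ContinuousLinearMap.compL ℝ E E E).bilinearComp (Γ z) (Γ z)
    - ((ContinuousLinearMap.compL ℝ E E E).bilinearComp (Γ z) (Γ z)).flip

lemma curv_apply (Γ : E → E →L[ℝ] E →L[ℝ] E) (z u v w : E) :
    curv Γ z u v w = fderiv ℝ Γ z u v w - fderiv ℝ Γ z v u w
      + Γ z u (Γ z v w) - Γ z v (Γ z u w) := by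
  simp [curv]

/-- The covariant derivative of the curvature tensor. -/
def nablaCurv (Γ : E → E →L[ℝ] E →L[ℝ] E) (z s u v w : E) : E :=
  fderiv ℝ (curv Γ) z s u v w + Γ z s (curv Γ z u v w) - curv Γ z (Γ z s u) v w
    - curv Γ z u (Γ z s v) w - curv Γ z u v (Γ z s w)

/-- The covariant derivative of vector fields on an open subset of `E`. -/
def nabla (Γ : E → E →L[ℝ] E →L[ℝ] E) (X Y : E → E) (z : E) : E :=
  fderiv ℝ Y z (X z) + Γ z (X z) (Y z)

/-- `Γ` are the Christoffel symbols of the Levi-Civita connection of the metric `g` on the open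
subset `Ω` of `E`. -/
structure IsLeviCivitaOn (Ω : Set E) (g : E → E →L[ℝ] E →L[ℝ] ℝ)
    (Γ : E → E →L[ℝ] E →L[ℝ] E) : Prop where
  isOpen : IsOpen Ω
  contDiffOn_metric : ContDiffOn ℝ ∞ g Ω
  symm_metric : ∀ z ∈ Ω, ∀ u v, g z u v = g z v u
  pos_metric : ∀ z ∈ Ω, ∀ u, u ≠ 0 → 0 < g z u u
  symm : ∀ z ∈ Ω, ∀ u v, Γ z u v = Γ z v u
  compat : ∀ z ∈ Ω, ∀ s u v, fderiv ℝ g z s u v = g z (Γ z s u) v + g z u (Γ z s v)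

lemma curv_swap (Γ : E → E →L[ℝ] E →L[ℝ] E) (z u v w : E) :
    curv Γ z u v w = - curv Γ z v u w := by
  simp only [curv_apply]; abel

section Smooth

variable {Ω : Set E} {Γ : E → E →L[ℝ] E →L[ℝ] E}

lemma contDiffOn_curv [FiniteDimensional ℝ E] (hΩ : IsOpen Ω) (hΓ : ContDiffOn ℝ ∞ Γ Ω) :
    ContDiffOn ℝ ∞ (curv Γ) Ω := by
  have hD : ContDiffOn ℝ ∞ (fderiv ℝ Γ) Ω := hΓ.fderiv_of_isOpen hΩ (by simp)
  refine contDiffOn_clm_apply.2 fun u ↦ contDiffOn_clm_apply.2 fun v ↦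
    contDiffOn_clm_apply.2 fun w ↦ ?_
  simp only [curv_apply]
  have hc : ∀ u v : E, ContDiffOn ℝ ∞ (fun z ↦ Γ z u v) Ω := fun u v ↦
    (hΓ.clm_apply contDiffOn_const).clm_apply contDiffOn_const
  have hc' : ∀ u v w : E, ContDiffOn ℝ ∞ (fun z ↦ fderiv ℝ Γ z u v w) Ω := fun u v w ↦
    ((hD.clm_apply contDiffOn_const).clm_apply contDiffOn_const).clm_apply contDiffOn_const
  exact (((hc' u v w).sub (hc' v u w)).add
    ((hΓ.clm_apply contDiffOn_const).clm_apply (hc v w))).sub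
    ((hΓ.clm_apply contDiffOn_const).clm_apply (hc u w))

lemma contDiffOn_nabla (hΩ : IsOpen Ω) (hΓ : ContDiffOn ℝ ∞ Γ Ω) {X Y : E → E}
    (hX : ContDiffOn ℝ ∞ X Ω) (hY : ContDiffOn ℝ ∞ Y Ω) : ContDiffOn ℝ ∞ (nabla Γ X Y) Ω := by
  have hD : ContDiffOn ℝ ∞ (fderiv ℝ Y) Ω := hY.fderiv_of_isOpen hΩ (by simp)
  exact (hD.clm_apply hX).add ((hΓ.clm_apply hX).clm_apply hY)

end Smooth

namespace IsLeviCivitaOn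

variable {Ω : Set E} {g : E → E →L[ℝ] E →L[ℝ] ℝ} {Γ : E → E →L[ℝ] E →L[ℝ] E}

lemma koszul (h : IsLeviCivitaOn Ω g Γ) {z : E} (hz : z ∈ Ω) (u v w : E) :
    g z (Γ z u v) w
      = 2⁻¹ * (fderiv ℝ g z u v w + fderiv ℝ g z v u w - fderiv ℝ g z w u v) := by
  rw [h.compat z hz, h.compat z hz, h.compat z hz, h.symm z hz v u, h.symm z hz w u,
    h.symm z hz w v, h.symm_metric z hz v (Γ z u w)]
  ring

lemma exists_equiv [FiniteDimensional ℝ E] (h : IsLeviCivitaOn Ω g Γ) {z : E} (hz : z ∈ Ω) :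
    ∃ e : E ≃L[ℝ] (E →L[ℝ] ℝ), (e : E →L[ℝ] (E →L[ℝ] ℝ)) = g z := by
  have hinj : Function.Injective (g z) := by
    rw [injective_iff_map_eq_zero]
    intro u hu
    by_contra hne
    have := h.pos_metric z hz u hne
    simp [hu] at this
  have hd : Module.finrank ℝ E = Module.finrank ℝ (E →L[ℝ] ℝ) := by
    rw [← LinearEquiv.finrank_eq (LinearMap.toContinuousLinearMap (𝕜 := ℝ) (E := E) (F' := ℝ))]
    exact (Subspace.dual_finrank_eq (K := ℝ) (V := E)).symm
  refine ⟨(LinearEquiv.ofInjectiveOfFinrankEq (g z : E →ₗ[ℝ] (E →L[ℝ] ℝ)) hinj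
    hd).toContinuousLinearEquiv, ?_⟩
  ext u v
  rfl

lemma contDiffOn [FiniteDimensional ℝ E] (h : IsLeviCivitaOn Ω g Γ) : ContDiffOn ℝ ∞ Γ Ω := by
  have hD : ContDiffOn ℝ ∞ (fderiv ℝ g) Ω := h.contDiffOn_metric.fderiv_of_isOpen h.isOpen (by simp)
  have hinv : ContDiffOn ℝ ∞ (fun z ↦ (g z).inverse) Ω := by
    intro z hz
    obtain ⟨e, he⟩ := h.exists_equiv hz
    have := contDiffAt_map_inverse (𝕜 := ℝ) (n := ∞) e
    rw [he] at this
    exact this.comp_contDiffWithinAt z (h.contDiffOn_metric z hz)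
  refine contDiffOn_clm_apply.2 fun u ↦ contDiffOn_clm_apply.2 fun v ↦ ?_
  have hK : ContDiffOn ℝ ∞ (fun z ↦ (2⁻¹ : ℝ) • (fderiv ℝ g z u v + fderiv ℝ g z v u
      - ((fderiv ℝ g z).flip u).flip v)) Ω := by
    refine contDiffOn_clm_apply.2 fun w ↦ ?_
    simp only [smul_apply, add_apply, sub_apply,
      ContinuousLinearMap.flip_apply]
    fun_prop
  refine (hinv.clm_apply hK).congr fun z hz ↦ ?_
  obtain ⟨e, he⟩ := h.exists_equiv hz
  have : (2⁻¹ : ℝ) • (fderiv ℝ g z u v + fderiv ℝ g z v u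
      - ((fderiv ℝ g z).flip u).flip v) = g z (Γ z u v) := by
    ext w
    rw [h.koszul hz]
    simp
  rw [this, ← he, ContinuousLinearMap.inverse_equiv]
  simp

lemma differentiableAt_metric (h : IsLeviCivitaOn Ω g Γ) {z : E} (hz : z ∈ Ω) :
    DifferentiableAt ℝ g z :=
  (h.contDiffOn_metric.contDiffAt (h.isOpen.mem_nhds hz)).differentiableAt (by simp)

variable [FiniteDimensional ℝ E]

lemma differentiableAt (h : IsLeviCivitaOn Ω g Γ) {z : E} (hz : z ∈ Ω) :
    DifferentiableAt ℝ Γ z :=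
  (h.contDiffOn.contDiffAt (h.isOpen.mem_nhds hz)).differentiableAt (by simp)

lemma differentiableAt_curv (h : IsLeviCivitaOn Ω g Γ) {z : E} (hz : z ∈ Ω) :
    DifferentiableAt ℝ (curv Γ) z :=
  ((contDiffOn_curv h.isOpen h.contDiffOn).contDiffAt
    (h.isOpen.mem_nhds hz)).differentiableAt (by simp)

lemma fderiv_symm (h : IsLeviCivitaOn Ω g Γ) {z : E} (hz : z ∈ Ω) (s u v : E) :
    fderiv ℝ Γ z s u v = fderiv ℝ Γ z s v u := by
  have key : ∀ u v : E, fderiv ℝ (fun z ↦ Γ z u v) z s = fderiv ℝ Γ z s u v := by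
    intro u v
    have h1 : HasFDerivAt (fun z ↦ Γ z u v) _ z :=
      (((h.differentiableAt hz).hasFDerivAt).clm_apply (hasFDerivAt_const u z)).clm_apply
        (hasFDerivAt_const v z)
    rw [h1.fderiv]; simp
  rw [← key, ← key]
  congr 1
  apply Filter.EventuallyEq.fderiv_eq
  filter_upwards [h.isOpen.mem_nhds hz] with z' hz'
  exact h.symm z' hz' u v

/-- The first Bianchi identity. -/
lemma bianchi (h : IsLeviCivitaOn Ω g Γ) {z : E} (hz : z ∈ Ω) (u v w : E) :
    curv Γ z u v w + curv Γ z v w u + curv Γ z w u v = 0 := by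
  simp only [curv_apply]
  rw [h.fderiv_symm hz u v w, h.fderiv_symm hz v u w, h.fderiv_symm hz w u v,
    h.symm z hz v w, h.symm z hz u w, h.symm z hz v u]
  abel

lemma metric_curv_antisymm (h : IsLeviCivitaOn Ω g Γ) {z : E} (hz : z ∈ Ω) (u v w s : E) :
    g z (curv Γ z u v w) s = - g z w (curv Γ z u v s) := by
  have hΩ := h.isOpen.mem_nhds hz
  have hg := h.contDiffOn_metric.contDiffAt hΩ
  have hDg : DifferentiableAt ℝ (fderiv ℝ g) z :=
    (hg.fderiv_right (m := 1) (by norm_cast)).differentiableAt (by simp)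
  have hsym : IsSymmSndFDerivAt ℝ g z := hg.isSymmSndFDerivAt (by simp; norm_cast)
  have hΓ := (h.differentiableAt hz).hasFDerivAt
  have hg' := (h.differentiableAt_metric hz).hasFDerivAt
  have key : ∀ u v : E, fderiv ℝ (fderiv ℝ g) z u v w s
      = (g z (fderiv ℝ Γ z u v w) s + g z (Γ z u (Γ z v w)) s + g z (Γ z v w) (Γ z u s))
        + (g z w (fderiv ℝ Γ z u v s) + g z (Γ z u w) (Γ z v s) + g z w (Γ z u (Γ z v s))) := by
    intro u v
    have h1 : HasFDerivAt (fun z ↦ fderiv ℝ g z v w s) _ z :=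
      ((hDg.hasFDerivAt.clm_apply (hasFDerivAt_const v z)).clm_apply
        (hasFDerivAt_const w z)).clm_apply (hasFDerivAt_const s z)
    have h2 : ∀ w s : E, HasFDerivAt (fun z ↦ g z (Γ z v w) s) _ z := fun w s ↦
      (hg'.clm_apply ((hΓ.clm_apply (hasFDerivAt_const v z)).clm_apply
        (hasFDerivAt_const w z))).clm_apply (hasFDerivAt_const s z)
    have h3 : HasFDerivAt (fun z ↦ g z w (Γ z v s)) _ z :=
      (hg'.clm_apply (hasFDerivAt_const w z)).clm_apply
        ((hΓ.clm_apply (hasFDerivAt_const v z)).clm_apply (hasFDerivAt_const s z))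
    have heq : (fun z ↦ fderiv ℝ g z v w s) =ᶠ[𝓝 z]
        fun z ↦ g z (Γ z v w) s + g z w (Γ z v s) := by
      filter_upwards [hΩ] with z' hz'
      exact h.compat z' hz' v w s
    have h4 := (h1.congr_of_eventuallyEq heq.symm).unique ((h2 w s).add h3)
    have h5 := DFunLike.congr_fun h4 u
    simp only [add_apply, ContinuousLinearMap.comp_apply,
      ContinuousLinearMap.flip_apply, zero_add,
      ContinuousLinearMap.comp_zero, h.compat z hz] at h5
    rw [h5]
    ring
  have h6 := hsym u v
  have h7 := congrArg (fun f : E →L[ℝ] E →L[ℝ] ℝ ↦ f w s) h6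
  simp only [key] at h7
  simp only [curv_apply, map_add, map_sub, add_apply,
    sub_apply]
  linarith

lemma metric_curv_pair (h : IsLeviCivitaOn Ω g Γ) {z : E} (hz : z ∈ Ω) (u v w s : E) :
    g z (curv Γ z u v w) s = g z (curv Γ z w s u) v := by
  have hb : ∀ a b c d : E, g z (curv Γ z a b c) d + g z (curv Γ z b c a) d
      + g z (curv Γ z c a b) d = 0 := by
    intro a b c d
    rw [← add_apply, ← add_apply, ← map_add, ← map_add,
      h.bianchi hz]
    simp
  have h1 : ∀ a b c d : E, g z (curv Γ z a b c) d = - g z (curv Γ z b a c) d := by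
    intro a b c d
    rw [curv_swap, map_neg, neg_apply]
  have h2 : ∀ a b c d : E, g z (curv Γ z a b c) d = - g z (curv Γ z a b d) c := by
    intro a b c d
    rw [h.metric_curv_antisymm hz, h.symm_metric z hz]
  linarith [hb u v w s, hb v w s u, hb w s u v, hb s u v w, h1 w u v s, h2 v w s u, h2 w s v u,
    h1 s v w u, h2 v s w u, h1 s u w v, h2 u s w v, h2 u w s v, h1 s u v w, h2 u v s w]

end IsLeviCivitaOn

end LocalConnection

namespace LocalConnection

variable {E : Type*} [NormedAddCommGroup E] [NormedSpace ℝ E]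

/-- The tangent vector of `E × E` at `p` with horizontal part `w` and vertical part `q`. -/
def lift (Γ : E → E →L[ℝ] E →L[ℝ] E) (p : E × E) (w q : E) : E × E :=
  (w, q - Γ p.1 w p.2)

/-- The vertical part of a tangent vector of `E × E` at `p`. -/
def vert (Γ : E → E →L[ℝ] E →L[ℝ] E) (p ξ : E × E) : E :=
  ξ.2 + Γ p.1 ξ.1 p.2

/-- The covariant derivative of a vector field along the projection `E × E → E`. -/
def covAlong (Γ : E → E →L[ℝ] E →L[ℝ] E) (W : E × E → E) (p ξ : E × E) : E :=
  fderiv ℝ W p ξ + Γ p.1 ξ.1 (W p)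

/-- The metric `a gˢ + b gʰ + c gᵛ` in a chart of the tangent bundle. -/
def liftMetric (a b c : ℝ) (g : E → E →L[ℝ] E →L[ℝ] ℝ) (Γ : E → E →L[ℝ] E →L[ℝ] E)
    (p ξ η : E × E) : ℝ :=
  (a + c) * g p.1 ξ.1 η.1 + b * (g p.1 ξ.1 (vert Γ p η) + g p.1 (vert Γ p ξ) η.1)
    + a * g p.1 (vert Γ p ξ) (vert Γ p η)

/-- The horizontal part of `∇_ξ η - D_ξ η`, where `ξ` has parts `u`, `v` and `η` has parts
`w`, `q`. -/
def corrH (a b α : ℝ) (Γ : E → E →L[ℝ] E →L[ℝ] E) (p : E × E) (u v w q : E) : E :=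
  -(a * b / (2 * α)) • (curv Γ p.1 u p.2 w + curv Γ p.1 w p.2 u)
    - (a ^ 2 / (2 * α)) • (curv Γ p.1 v p.2 w + curv Γ p.1 q p.2 u)

/-- The vertical part of `∇_ξ η - D_ξ η`, where `ξ` has parts `u`, `v` and `η` has parts
`w`, `q`. -/
def corrV (a b c α : ℝ) (Γ : E → E →L[ℝ] E →L[ℝ] E) (p : E × E) (u v w q : E) : E :=
  (b ^ 2 / α) • curv Γ p.1 u p.2 w - (a * (a + c) / (2 * α)) • curv Γ p.1 u w p.2
    + (a * b / (2 * α)) • (curv Γ p.1 v p.2 w + curv Γ p.1 q p.2 u)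

/-- The Christoffel symbols of the Levi-Civita connection of `liftMetric a b c g Γ`. -/
def liftChristoffel (a b c α : ℝ) (Γ : E → E →L[ℝ] E →L[ℝ] E) (p ξ η : E × E) : E × E :=
  lift Γ p
    (Γ p.1 ξ.1 η.1 + corrH a b α Γ p ξ.1 (vert Γ p ξ) η.1 (vert Γ p η))
    (fderiv ℝ Γ p.1 ξ.1 η.1 p.2 + Γ p.1 η.1 ξ.2 + Γ p.1 ξ.1 (vert Γ p η)
      + corrV a b c α Γ p ξ.1 (vert Γ p ξ) η.1 (vert Γ p η))

@[simp] lemma lift_fst (Γ : E → E →L[ℝ] E →L[ℝ] E) (p : E × E) (w q : E) :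
    (lift Γ p w q).1 = w := rfl

@[simp] lemma vert_lift (Γ : E → E →L[ℝ] E →L[ℝ] E) (p : E × E) (w q : E) :
    vert Γ p (lift Γ p w q) = q := by simp [vert, lift]

lemma lift_vert (Γ : E → E →L[ℝ] E →L[ℝ] E) (p ξ : E × E) :
    lift Γ p ξ.1 (vert Γ p ξ) = ξ := by simp [vert, lift]

lemma lift_sub (Γ : E → E →L[ℝ] E →L[ℝ] E) (p : E × E) (w q w' q' : E) :
    lift Γ p w q - lift Γ p w' q' = lift Γ p (w - w') (q - q') := by
  ext
  · simp [lift]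
  · simp [lift]; abel

lemma vert_sub (Γ : E → E →L[ℝ] E →L[ℝ] E) (p ξ η : E × E) :
    vert Γ p (ξ - η) = vert Γ p ξ - vert Γ p η := by
  simp [vert]; abel

namespace IsLeviCivitaOn

variable {Ω : Set E} {g : E → E →L[ℝ] E →L[ℝ] ℝ} {Γ : E → E →L[ℝ] E →L[ℝ] E}

lemma eq_zero_of_liftMetric_self (h : IsLeviCivitaOn Ω g Γ) {a b c : ℝ} (ha : 0 < a)
    (hα : 0 < a * (a + c) - b ^ 2) {p : E × E} (hp : p.1 ∈ Ω) {ξ : E × E}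
    (hξ : liftMetric a b c g Γ p ξ ξ = 0) : ξ = 0 := by
  have hnn : ∀ u, 0 ≤ g p.1 u u := fun u ↦ by
    rcases eq_or_ne u 0 with rfl | hu
    · simp
    · exact (h.pos_metric _ hp u hu).le
  have hz : ∀ u, g p.1 u u = 0 → u = 0 := fun u hu ↦ by
    by_contra hne
    exact (h.pos_metric _ hp u hne).ne' hu
  have key : a * liftMetric a b c g Γ p ξ ξ
      = g p.1 (a • vert Γ p ξ + b • ξ.1) (a • vert Γ p ξ + b • ξ.1)
        + (a * (a + c) - b ^ 2) * g p.1 ξ.1 ξ.1 := by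
    simp only [liftMetric, map_add, map_smul, add_apply, smul_apply, smul_eq_mul,
      h.symm_metric _ hp ξ.1 (vert Γ p ξ)]
    ring
  rw [hξ, mul_zero] at key
  have h1 := hnn (a • vert Γ p ξ + b • ξ.1)
  have h2 := mul_nonneg hα.le (hnn ξ.1)
  have h3 : ξ.1 = 0 := by
    apply hz
    have : (a * (a + c) - b ^ 2) * g p.1 ξ.1 ξ.1 = 0 := by linarith
    exact (mul_eq_zero.1 this).resolve_left hα.ne'
  have h4 : vert Γ p ξ = 0 := by
    have h5 := hz _ (le_antisymm (by linarith) h1)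
    rw [h3, smul_zero, add_zero] at h5
    exact (smul_eq_zero.1 h5).resolve_left ha.ne'
  rw [← lift_vert Γ p ξ, h3, h4]
  simp [lift]

/-- A difference of two Levi-Civita connections of `liftMetric a b c g Γ` vanishes. -/
lemma eq_zero_of_liftMetric_antisymm (h : IsLeviCivitaOn Ω g Γ) {a b c : ℝ} (ha : 0 < a)
    (hα : 0 < a * (a + c) - b ^ 2) {p : E × E} (hp : p.1 ∈ Ω) {S : E × E → E × E → E × E}
    (hS : ∀ ξ η, S ξ η = S η ξ)
    (hS' : ∀ ζ ξ η, liftMetric a b c g Γ p (S ζ ξ) η + liftMetric a b c g Γ p ξ (S ζ η) = 0)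
    (ξ η : E × E) : S ξ η = 0 := by
  have hsymm : ∀ ξ η, liftMetric a b c g Γ p ξ η = liftMetric a b c g Γ p η ξ := fun ξ η ↦ by
    simp only [liftMetric, h.symm_metric _ hp ξ.1, h.symm_metric _ hp (vert Γ p ξ)]
    ring
  have anti : ∀ ζ ξ η, liftMetric a b c g Γ p (S ζ ξ) η = - liftMetric a b c g Γ p (S ζ η) ξ :=
    fun ζ ξ η ↦ by rw [hsymm (S ζ η) ξ]; linarith [hS' ζ ξ η]
  have hzero : ∀ ζ ξ η, liftMetric a b c g Γ p (S ζ ξ) η = 0 := fun ζ ξ η ↦ by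
    have h1 := anti ξ ζ η
    have h2 := anti η ξ ζ
    have h3 := anti ζ η ξ
    rw [hS ξ ζ] at h1
    rw [hS η ξ, hS η ζ] at h2
    linarith
  exact h.eq_zero_of_liftMetric_self ha hα hp (hzero _ _ _)

lemma fderiv_metric_along (h : IsLeviCivitaOn Ω g Γ) {p : E × E} (hp : p.1 ∈ Ω)
    {W W' : E × E → E} (hW : DifferentiableAt ℝ W p) (hW' : DifferentiableAt ℝ W' p)
    (ξ : E × E) :
    DifferentiableAt ℝ (fun q ↦ g q.1 (W q) (W' q)) p ∧
    fderiv ℝ (fun q ↦ g q.1 (W q) (W' q)) p ξ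
      = g p.1 (covAlong Γ W p ξ) (W' p) + g p.1 (W p) (covAlong Γ W' p ξ) := by
  have hg : HasFDerivAt (fun q : E × E ↦ g q.1)
      ((fderiv ℝ g p.1).comp (ContinuousLinearMap.fst ℝ E E)) p :=
    (h.differentiableAt_metric hp).hasFDerivAt.comp p hasFDerivAt_fst
  have h1 := (hg.clm_apply hW.hasFDerivAt).clm_apply hW'.hasFDerivAt
  refine ⟨h1.differentiableAt, ?_⟩
  rw [h1.fderiv]
  simp [covAlong, h.compat _ hp]
  ring

variable [FiniteDimensional ℝ E]

lemma curv_sub_curv (h : IsLeviCivitaOn Ω g Γ) {z : E} (hz : z ∈ Ω) (u v w : E) :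
    curv Γ z u v w - curv Γ z w v u = curv Γ z u w v := by
  rw [curv_swap Γ z w v u, curv_swap Γ z u w v]
  rw [← sub_eq_zero, ← h.bianchi hz u v w]
  abel

lemma lower_corr_fst (h : IsLeviCivitaOn Ω g Γ) {a b c α : ℝ} (hα : α = a * (a + c) - b ^ 2)
    (hα0 : α ≠ 0) {p : E × E} (hp : p.1 ∈ Ω) (u v w q : E) :
    (a + c) • corrH a b α Γ p u v w q + b • corrV a b c α Γ p u v w q
      = -b • curv Γ p.1 u p.2 w
        - (a / 2) • (curv Γ p.1 v p.2 w + curv Γ p.1 q p.2 u) := by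
  simp only [corrH, corrV, ← h.curv_sub_curv hp u p.2 w]
  match_scalars <;> field_simp <;> rw [hα] <;> ring

lemma lower_corr_snd (h : IsLeviCivitaOn Ω g Γ) {a b c α : ℝ} (hα : α = a * (a + c) - b ^ 2)
    (hα0 : α ≠ 0) {p : E × E} (hp : p.1 ∈ Ω) (u v w q : E) :
    b • corrH a b α Γ p u v w q + a • corrV a b c α Γ p u v w q
      = -(a / 2) • curv Γ p.1 u w p.2 := by
  simp only [corrH, corrV, ← h.curv_sub_curv hp u p.2 w]
  match_scalars <;> field_simp <;> rw [hα] <;> ring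

/-- The tensorial part of the connection is skew-symmetric. -/
lemma corr_antisymm (h : IsLeviCivitaOn Ω g Γ) {a b c α : ℝ} (hα : α = a * (a + c) - b ^ 2)
    (hα0 : α ≠ 0) {p : E × E} (hp : p.1 ∈ Ω) (u v w q w' q' : E) :
    g p.1 ((a + c) • corrH a b α Γ p u v w q + b • corrV a b c α Γ p u v w q) w'
      + g p.1 (b • corrH a b α Γ p u v w q + a • corrV a b c α Γ p u v w q) q'
      + (g p.1 ((a + c) • corrH a b α Γ p u v w' q' + b • corrV a b c α Γ p u v w' q') w
      + g p.1 (b • corrH a b α Γ p u v w' q' + a • corrV a b c α Γ p u v w' q') q) = 0 := by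
  rw [h.lower_corr_fst hα hα0 hp, h.lower_corr_fst hα hα0 hp, h.lower_corr_snd hα hα0 hp,
    h.lower_corr_snd hα hα0 hp]
  have h2 : ∀ a b c d : E, g p.1 (curv Γ p.1 a b c) d = - g p.1 (curv Γ p.1 a b d) c := by
    intro a b c d
    rw [h.metric_curv_antisymm hp, h.symm_metric _ hp]
  simp only [map_add, map_sub, map_smul, add_apply, sub_apply, smul_apply, smul_eq_mul]
  rw [h2 u p.2 w w', h2 v p.2 w w', h.metric_curv_pair hp q p.2 u w',
    h.metric_curv_pair hp q' p.2 u w, h2 u w' q p.2, h2 u w q' p.2]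
  ring

lemma hasFDerivAt_comp_fst (h : IsLeviCivitaOn Ω g Γ) {p : E × E} (hp : p.1 ∈ Ω) :
    HasFDerivAt (fun q : E × E ↦ Γ q.1)
      ((fderiv ℝ Γ p.1).comp (ContinuousLinearMap.fst ℝ E E)) p :=
  (h.differentiableAt hp).hasFDerivAt.comp p hasFDerivAt_fst

lemma hasFDerivAt_vert (h : IsLeviCivitaOn Ω g Γ) {p : E × E} (hp : p.1 ∈ Ω)
    {F : E × E → E × E} (hF : DifferentiableAt ℝ F p) :
    ∃ L : E × E →L[ℝ] E, HasFDerivAt (fun q ↦ vert Γ q (F q)) L p ∧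
      ∀ ξ, L ξ = (fderiv ℝ F p ξ).2 + (fderiv ℝ Γ p.1 ξ.1 (F p).1 p.2
        + Γ p.1 (fderiv ℝ F p ξ).1 p.2 + Γ p.1 (F p).1 ξ.2) := by
  have h1 := hF.hasFDerivAt.snd.add
    (((h.hasFDerivAt_comp_fst hp).clm_apply hF.hasFDerivAt.fst).clm_apply
      (hasFDerivAt_snd (𝕜 := ℝ) (p := p)))
  refine ⟨_, h1, fun ξ ↦ ?_⟩
  simp
  abel

/-- The connection with Christoffel symbols `liftChristoffel` in terms of horizontal and vertical
parts. -/
lemma fderiv_add_liftChristoffel (h : IsLeviCivitaOn Ω g Γ) {p : E × E} (hp : p.1 ∈ Ω)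
    (a b c α : ℝ) {F : E × E → E × E} (hF : DifferentiableAt ℝ F p) (ξ : E × E) :
    fderiv ℝ F p ξ + liftChristoffel a b c α Γ p ξ (F p)
      = lift Γ p
        (covAlong Γ (fun q ↦ (F q).1) p ξ
          + corrH a b α Γ p ξ.1 (vert Γ p ξ) (F p).1 (vert Γ p (F p)))
        (covAlong Γ (fun q ↦ vert Γ q (F q)) p ξ
          + corrV a b c α Γ p ξ.1 (vert Γ p ξ) (F p).1 (vert Γ p (F p))) := by
  obtain ⟨L, hL, hL'⟩ := h.hasFDerivAt_vert hp hF
  have h1 : fderiv ℝ (fun q ↦ (F q).1) p ξ = (fderiv ℝ F p ξ).1 := by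
    rw [hF.hasFDerivAt.fst.fderiv]; rfl
  simp only [covAlong, hL.fderiv, hL', h1, liftChristoffel, lift]
  ext
  · simp; abel
  · simp only [Prod.snd_add, map_add, add_apply]; abel

lemma fderiv_liftMetric (h : IsLeviCivitaOn Ω g Γ) {a b c α : ℝ}
    (hα : α = a * (a + c) - b ^ 2) (hα0 : α ≠ 0) {p : E × E} (hp : p.1 ∈ Ω) (ζ ξ η : E × E) :
    DifferentiableAt ℝ (fun q ↦ liftMetric a b c g Γ q ξ η) p ∧
    fderiv ℝ (fun q ↦ liftMetric a b c g Γ q ξ η) p ζ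
      = liftMetric a b c g Γ p (liftChristoffel a b c α Γ p ζ ξ) η
        + liftMetric a b c g Γ p ξ (liftChristoffel a b c α Γ p ζ η) := by
  have hd : ∀ w : E, DifferentiableAt ℝ (fun _ : E × E ↦ w) p := fun w ↦
    differentiableAt_const w
  have hv : ∀ η : E × E, DifferentiableAt ℝ (fun q ↦ vert Γ q η) p := fun η ↦ by
    obtain ⟨L, hL, -⟩ := h.hasFDerivAt_vert hp (differentiableAt_const η)
    exact hL.differentiableAt
  obtain ⟨d1, e1⟩ := h.fderiv_metric_along hp (hd ξ.1) (hd η.1) ζ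
  obtain ⟨d2, e2⟩ := h.fderiv_metric_along hp (hd ξ.1) (hv η) ζ
  obtain ⟨d3, e3⟩ := h.fderiv_metric_along hp (hv ξ) (hd η.1) ζ
  obtain ⟨d4, e4⟩ := h.fderiv_metric_along hp (hv ξ) (hv η) ζ
  have hL := ((d1.hasFDerivAt.const_mul (a + c)).add
    ((d2.hasFDerivAt.add d3.hasFDerivAt).const_mul b)).add (d4.hasFDerivAt.const_mul a)
  refine ⟨hL.differentiableAt, ?_⟩
  have h1 := h.fderiv_add_liftChristoffel hp a b c α (differentiableAt_const ξ) ζ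
  have h2 := h.fderiv_add_liftChristoffel hp a b c α (differentiableAt_const η) ζ
  simp only [fderiv_fun_const, Pi.zero_apply, zero_apply, zero_add] at h1 h2
  rw [h1, h2]
  have h3 := h.corr_antisymm hα hα0 hp ζ.1 (vert Γ p ζ) ξ.1 (vert Γ p ξ) η.1 (vert Γ p η)
  have h4 : fderiv ℝ (fun q ↦ liftMetric a b c g Γ q ξ η) p ζ = _ :=
    DFunLike.congr_fun hL.fderiv ζ
  rw [h4]
  simp only [add_apply, smul_apply, smul_eq_mul, e1, e2, e3, e4]
  simp only [liftMetric, lift_fst, vert_lift]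
  simp only [map_add, map_smul, add_apply, smul_apply, smul_eq_mul] at h3 ⊢
  rw [h.symm_metric _ hp ξ.1 (corrH _ _ _ _ _ _ _ _ _), h.symm_metric _ hp ξ.1 (corrV _ _ _ _ _ _ _ _ _ _),
    h.symm_metric _ hp (vert Γ p ξ) (corrH _ _ _ _ _ _ _ _ _),
    h.symm_metric _ hp (vert Γ p ξ) (corrV _ _ _ _ _ _ _ _ _ _)]
  linear_combination -h3

lemma liftChristoffel_symm (h : IsLeviCivitaOn Ω g Γ) {a b c α : ℝ}
    (hα : α = a * (a + c) - b ^ 2) (hα0 : α ≠ 0) {p : E × E} (hp : p.1 ∈ Ω) (ξ η : E × E) :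
    liftChristoffel a b c α Γ p ξ η = liftChristoffel a b c α Γ p η ξ := by
  have hH : corrH a b α Γ p ξ.1 (vert Γ p ξ) η.1 (vert Γ p η)
      = corrH a b α Γ p η.1 (vert Γ p η) ξ.1 (vert Γ p ξ) := by
    simp only [corrH]
    module
  have hV : corrV a b c α Γ p ξ.1 (vert Γ p ξ) η.1 (vert Γ p η)
      = corrV a b c α Γ p η.1 (vert Γ p η) ξ.1 (vert Γ p ξ) - curv Γ p.1 ξ.1 η.1 p.2 := by
    simp only [corrV, ← h.curv_sub_curv hp ξ.1 p.2 η.1, ← h.curv_sub_curv hp η.1 p.2 ξ.1]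
    match_scalars <;> field_simp <;> rw [hα] <;> ring
  simp only [liftChristoffel, hH, hV, h.symm _ hp η.1 ξ.1]
  congr 1
  simp only [curv_apply, vert, map_add, h.symm _ hp ξ.1 η.2, h.symm _ hp η.1 ξ.2]
  abel

/-- The Christoffel symbols of the Levi-Civita connection of `liftMetric a b c g Γ`. -/
lemma eq_liftChristoffel (h : IsLeviCivitaOn Ω g Γ) {a b c α : ℝ} (ha : 0 < a)
    (hα : α = a * (a + c) - b ^ 2) (hαpos : 0 < α) {p : E × E} (hp : p.1 ∈ Ω)
    {Γ' : E × E → E × E → E × E} (hsymm : ∀ ξ η, Γ' ξ η = Γ' η ξ)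
    (hcompat : ∀ ζ ξ η, fderiv ℝ (fun q ↦ liftMetric a b c g Γ q ξ η) p ζ
      = liftMetric a b c g Γ p (Γ' ζ ξ) η + liftMetric a b c g Γ p ξ (Γ' ζ η)) (ξ η : E × E) :
    Γ' ξ η = liftChristoffel a b c α Γ p ξ η := by
  rw [← sub_eq_zero]
  refine h.eq_zero_of_liftMetric_antisymm ha (hα ▸ hαpos) hp
    (S := fun ξ η ↦ Γ' ξ η - liftChristoffel a b c α Γ p ξ η) (fun ξ η ↦ ?_) (fun ζ ξ η ↦ ?_) ξ η
  · rw [hsymm, h.liftChristoffel_symm hα hαpos.ne' hp]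
  · have h1 := hcompat ζ ξ η
    rw [(h.fderiv_liftMetric hα hαpos.ne' hp ζ ξ η).2] at h1
    simp only [liftMetric, vert_sub, Prod.fst_sub, map_sub, sub_apply] at h1 ⊢
    linear_combination -h1

end IsLeviCivitaOn

end LocalConnection

namespace LocalConnection

variable {E : Type*} [NormedAddCommGroup E] [NormedSpace ℝ E]

lemma nabla_congr {Γ Γ' : E → E →L[ℝ] E →L[ℝ] E} {X X' Y Y' : E → E} {z : E}
    (hΓ : Γ z = Γ' z) (hX : X z = X' z) (hY : Y =ᶠ[𝓝 z] Y') :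
    nabla Γ X Y z = nabla Γ' X' Y' z := by
  simp only [nabla, hΓ, hX, hY.fderiv_eq, hY.eq_of_nhds]

lemma nablaCurv_zero (Γ : E → E →L[ℝ] E →L[ℝ] E) (z u v w : E) : nablaCurv Γ z 0 u v w = 0 := by
  simp [nablaCurv]

section Along

variable {Γ : E → E →L[ℝ] E →L[ℝ] E} {p : E × E}

lemma covAlong_add {W W' : E × E → E} (hW : DifferentiableAt ℝ W p)
    (hW' : DifferentiableAt ℝ W' p) (ξ : E × E) :
    covAlong Γ (fun q ↦ W q + W' q) p ξ = covAlong Γ W p ξ + covAlong Γ W' p ξ := by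
  simp only [covAlong, fderiv_fun_add hW hW', add_apply, map_add]
  abel

lemma covAlong_sub {W W' : E × E → E} (hW : DifferentiableAt ℝ W p)
    (hW' : DifferentiableAt ℝ W' p) (ξ : E × E) :
    covAlong Γ (fun q ↦ W q - W' q) p ξ = covAlong Γ W p ξ - covAlong Γ W' p ξ := by
  simp only [covAlong, fderiv_fun_sub hW hW', sub_apply, map_sub]
  abel

lemma covAlong_smul (r : ℝ) {W : E × E → E} (hW : DifferentiableAt ℝ W p) (ξ : E × E) :
    covAlong Γ (fun q ↦ r • W q) p ξ = r • covAlong Γ W p ξ := by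
  simp only [covAlong, fderiv_fun_const_smul hW, smul_apply, map_smul, smul_add]

lemma covAlong_zero (ξ : E × E) : covAlong Γ (fun _ ↦ (0 : E)) p ξ = 0 := by
  simp [covAlong]

lemma covAlong_snd (ξ : E × E) : covAlong Γ (fun q ↦ q.2) p ξ = vert Γ p ξ := by
  simp [covAlong, vert, fderiv_snd]

lemma covAlong_comp_fst {X Y : E → E} (hY : DifferentiableAt ℝ Y p.1) {ξ : E × E}
    (hξ : ξ.1 = X p.1) : covAlong Γ (fun q ↦ Y q.1) p ξ = nabla Γ X Y p.1 := by
  have : HasFDerivAt (fun q : E × E ↦ Y q.1)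
      ((fderiv ℝ Y p.1).comp (ContinuousLinearMap.fst ℝ E E)) p :=
    hY.hasFDerivAt.comp p hasFDerivAt_fst
  simp [covAlong, nabla, this.fderiv, hξ]

lemma covAlong_comp_fst_of_vertical {Y : E → E} (hY : DifferentiableAt ℝ Y p.1) {ξ : E × E}
    (hξ : ξ.1 = 0) : covAlong Γ (fun q ↦ Y q.1) p ξ = 0 := by
  rw [covAlong_comp_fst (X := 0) hY hξ]
  simp [nabla]

end Along

namespace IsLeviCivitaOn

variable {Ω : Set E} {g : E → E →L[ℝ] E →L[ℝ] ℝ} {Γ : E → E →L[ℝ] E →L[ℝ] E}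
  [FiniteDimensional ℝ E]

lemma differentiableAt_curv_along (h : IsLeviCivitaOn Ω g Γ) {p : E × E} (hp : p.1 ∈ Ω)
    {U V W : E × E → E} (hU : DifferentiableAt ℝ U p) (hV : DifferentiableAt ℝ V p)
    (hW : DifferentiableAt ℝ W p) :
    DifferentiableAt ℝ (fun q ↦ curv Γ q.1 (U q) (V q) (W q)) p := by
  have hR : DifferentiableAt ℝ (fun q : E × E ↦ curv Γ q.1) p :=
    (h.differentiableAt_curv hp).comp p differentiableAt_fst
  exact ((hR.clm_apply hU).clm_apply hV).clm_apply hW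

lemma covAlong_curv (h : IsLeviCivitaOn Ω g Γ) {p : E × E} (hp : p.1 ∈ Ω)
    {U V W : E × E → E} (hU : DifferentiableAt ℝ U p) (hV : DifferentiableAt ℝ V p)
    (hW : DifferentiableAt ℝ W p) (ξ : E × E) :
    covAlong Γ (fun q ↦ curv Γ q.1 (U q) (V q) (W q)) p ξ
      = nablaCurv Γ p.1 ξ.1 (U p) (V p) (W p) + curv Γ p.1 (covAlong Γ U p ξ) (V p) (W p)
        + curv Γ p.1 (U p) (covAlong Γ V p ξ) (W p)
        + curv Γ p.1 (U p) (V p) (covAlong Γ W p ξ) := by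
  have hR : HasFDerivAt (fun q : E × E ↦ curv Γ q.1)
      ((fderiv ℝ (curv Γ) p.1).comp (ContinuousLinearMap.fst ℝ E E)) p :=
    (h.differentiableAt_curv hp).hasFDerivAt.comp p hasFDerivAt_fst
  have h1 := ((hR.clm_apply hU.hasFDerivAt).clm_apply hV.hasFDerivAt).clm_apply hW.hasFDerivAt
  simp only [covAlong, h1.fderiv, nablaCurv]
  simp
  abel

lemma differentiableAt_lift (h : IsLeviCivitaOn Ω g Γ) {p : E × E} (hp : p.1 ∈ Ω)
    {W Q : E × E → E} (hW : DifferentiableAt ℝ W p) (hQ : DifferentiableAt ℝ Q p) :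
    DifferentiableAt ℝ (fun q ↦ lift Γ q (W q) (Q q)) p :=
  hW.prodMk (hQ.sub (((h.hasFDerivAt_comp_fst hp).differentiableAt.clm_apply hW).clm_apply
    differentiableAt_snd))

variable {a b c α : ℝ} {Γ' : E × E → E × E →L[ℝ] E × E →L[ℝ] E × E}

lemma nabla_lift (h : IsLeviCivitaOn Ω g Γ) {p : E × E} (hp : p.1 ∈ Ω)
    (hΓ' : ∀ ξ η, Γ' p ξ η = liftChristoffel a b c α Γ p ξ η)
    {W Q : E × E → E} (hW : DifferentiableAt ℝ W p) (hQ : DifferentiableAt ℝ Q p)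
    (ζ : E × E → E × E) :
    nabla Γ' ζ (fun q ↦ lift Γ q (W q) (Q q)) p
      = lift Γ p
        (covAlong Γ W p (ζ p) + corrH a b α Γ p (ζ p).1 (vert Γ p (ζ p)) (W p) (Q p))
        (covAlong Γ Q p (ζ p) + corrV a b c α Γ p (ζ p).1 (vert Γ p (ζ p)) (W p) (Q p)) := by
  rw [nabla, hΓ', h.fderiv_add_liftChristoffel hp a b c α (h.differentiableAt_lift hp hW hQ)]
  simp only [lift_fst, vert_lift]

lemma nabla_vertical_horizontal (h : IsLeviCivitaOn Ω g Γ) {q : E × E} (hq : q.1 ∈ Ω)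
    (hΓ' : ∀ ξ η, Γ' q ξ η = liftChristoffel a b c α Γ q ξ η) (Y : E → E) {Z : E → E}
    (hZ : DifferentiableAt ℝ Z q.1) :
    nabla Γ' (fun q ↦ lift Γ q 0 (Y q.1)) (fun q ↦ lift Γ q (Z q.1) 0) q
      = lift Γ q (-(a ^ 2 / (2 * α)) • curv Γ q.1 (Y q.1) q.2 (Z q.1))
        ((a * b / (2 * α)) • curv Γ q.1 (Y q.1) q.2 (Z q.1)) := by
  rw [h.nabla_lift hq hΓ' (W := fun q ↦ Z q.1) (hZ.comp q differentiableAt_fst)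
    (differentiableAt_const _),
    covAlong_comp_fst_of_vertical hZ (by simp), covAlong_zero]
  simp [corrH, corrV]

lemma nabla_horizontal_horizontal (h : IsLeviCivitaOn Ω g Γ) {q : E × E} (hq : q.1 ∈ Ω)
    (hΓ' : ∀ ξ η, Γ' q ξ η = liftChristoffel a b c α Γ q ξ η) (X : E → E) {Z : E → E}
    (hZ : DifferentiableAt ℝ Z q.1) :
    nabla Γ' (fun q ↦ lift Γ q (X q.1) 0) (fun q ↦ lift Γ q (Z q.1) 0) q
      = lift Γ q (nabla Γ X Z q.1 + -(a * b / (2 * α)) •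
        (curv Γ q.1 (X q.1) q.2 (Z q.1) + curv Γ q.1 (Z q.1) q.2 (X q.1)))
        ((b ^ 2 / α) • curv Γ q.1 (X q.1) q.2 (Z q.1)
          - (a * (a + c) / (2 * α)) • curv Γ q.1 (X q.1) (Z q.1) q.2) := by
  rw [h.nabla_lift hq hΓ' (W := fun q ↦ Z q.1) (hZ.comp q differentiableAt_fst)
    (differentiableAt_const _),
    covAlong_comp_fst (X := X) hZ (by simp), covAlong_zero]
  simp [corrH, corrV]

lemma differentiableAt_nabla_vertical_horizontal (h : IsLeviCivitaOn Ω g Γ)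
    (hΓ' : ∀ p : E × E, p.1 ∈ Ω → ∀ ξ η, Γ' p ξ η = liftChristoffel a b c α Γ p ξ η)
    {Y Z : E → E} (hY : ContDiffOn ℝ ∞ Y Ω) (hZ : ContDiffOn ℝ ∞ Z Ω) {p : E × E}
    (hp : p.1 ∈ Ω) : DifferentiableAt ℝ
      (nabla Γ' (fun q ↦ lift Γ q 0 (Y q.1)) (fun q ↦ lift Γ q (Z q.1) 0)) p := by
  have hd : ∀ {X : E → E}, ContDiffOn ℝ ∞ X Ω → ∀ {q : E × E}, q.1 ∈ Ω →
      DifferentiableAt ℝ X q.1 := fun hX q hq ↦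
    (hX.contDiffAt (h.isOpen.mem_nhds hq)).differentiableAt (by simp)
  have dYZ := h.differentiableAt_curv_along hp ((hd hY hp).comp p differentiableAt_fst)
    differentiableAt_snd ((hd hZ hp).comp p differentiableAt_fst)
  refine (h.differentiableAt_lift hp (dYZ.const_smul (-(a ^ 2 / (2 * α))))
    (dYZ.const_smul (a * b / (2 * α)))).congr_of_eventuallyEq ?_
  filter_upwards [(h.isOpen.preimage continuous_fst).mem_nhds hp] with q hq
  exact h.nabla_vertical_horizontal hq (hΓ' q hq) Y (hd hZ hq)

lemma differentiableAt_nabla_horizontal_horizontal (h : IsLeviCivitaOn Ω g Γ)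
    (hΓ' : ∀ p : E × E, p.1 ∈ Ω → ∀ ξ η, Γ' p ξ η = liftChristoffel a b c α Γ p ξ η)
    {X Z : E → E} (hX : ContDiffOn ℝ ∞ X Ω) (hZ : ContDiffOn ℝ ∞ Z Ω) {p : E × E}
    (hp : p.1 ∈ Ω) : DifferentiableAt ℝ
      (nabla Γ' (fun q ↦ lift Γ q (X q.1) 0) (fun q ↦ lift Γ q (Z q.1) 0)) p := by
  have hd : ∀ {X : E → E}, ContDiffOn ℝ ∞ X Ω → ∀ {q : E × E}, q.1 ∈ Ω →
      DifferentiableAt ℝ X q.1 := fun hX q hq ↦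
    (hX.contDiffAt (h.isOpen.mem_nhds hq)).differentiableAt (by simp)
  have hd' : ∀ {X : E → E}, ContDiffOn ℝ ∞ X Ω →
      DifferentiableAt ℝ (fun q : E × E ↦ X q.1) p := fun hX ↦
    (hd hX hp).comp p differentiableAt_fst
  have dXZ := h.differentiableAt_curv_along hp (hd' hX) differentiableAt_snd (hd' hZ)
  have dZX := h.differentiableAt_curv_along hp (hd' hZ) differentiableAt_snd (hd' hX)
  have dXZ' := h.differentiableAt_curv_along hp (hd' hX) (hd' hZ) differentiableAt_snd
  refine (h.differentiableAt_lift hp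
    ((hd' (contDiffOn_nabla h.isOpen h.contDiffOn hX hZ)).add
      ((dXZ.add dZX).const_smul (-(a * b / (2 * α)))))
    ((dXZ.const_smul (b ^ 2 / α)).sub
      (dXZ'.const_smul (a * (a + c) / (2 * α))))).congr_of_eventuallyEq ?_
  filter_upwards [(h.isOpen.preimage continuous_fst).mem_nhds hp] with q hq
  exact h.nabla_horizontal_horizontal hq (hΓ' q hq) X (hd hZ hq)

/-- The curvature of the connection with Christoffel symbols `liftChristoffel` on a horizontal, a
vertical and a horizontal vector field. -/
lemma curv_lift (h : IsLeviCivitaOn Ω g Γ) (hα : α = a * (a + c) - b ^ 2) (hα0 : α ≠ 0)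
    (hΓ' : ∀ p : E × E, p.1 ∈ Ω → ∀ ξ η, Γ' p ξ η = liftChristoffel a b c α Γ p ξ η)
    {X Y Z : E → E} (hX : ContDiffOn ℝ ∞ X Ω) (hY : ContDiffOn ℝ ∞ Y Ω) (hZ : ContDiffOn ℝ ∞ Z Ω)
    {z : E} (hz : z ∈ Ω) (y : E) :
    nabla Γ' (fun q ↦ lift Γ q (X q.1) 0)
        (nabla Γ' (fun q ↦ lift Γ q 0 (Y q.1)) (fun q ↦ lift Γ q (Z q.1) 0)) (z, y)
      - nabla Γ' (fun q ↦ lift Γ q 0 (Y q.1))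
        (nabla Γ' (fun q ↦ lift Γ q (X q.1) 0) (fun q ↦ lift Γ q (Z q.1) 0)) (z, y)
      - nabla Γ' (fun q ↦ nabla Γ' (fun q ↦ lift Γ q (X q.1) 0) (fun q ↦ lift Γ q 0 (Y q.1)) q
          - nabla Γ' (fun q ↦ lift Γ q 0 (Y q.1)) (fun q ↦ lift Γ q (X q.1) 0) q)
        (fun q ↦ lift Γ q (Z q.1) 0) (z, y)
      = lift Γ (z, y)
          (-(a ^ 2 / (2 * α)) • nablaCurv Γ z (X z) (Y z) y (Z z)
            + (a ^ 3 * b / (4 * α ^ 2)) •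
                (curv Γ z (X z) y (curv Γ z (Y z) y (Z z))
                  - curv Γ z (Y z) y (curv Γ z (Z z) y (X z))
                  - curv Γ z (Y z) y (curv Γ z (X z) y (Z z)))
            + (a * b / (2 * α)) •
                (curv Γ z (X z) (Y z) (Z z) + curv Γ z (Z z) (Y z) (X z)))
          ((a * b / (2 * α)) • nablaCurv Γ z (X z) (Y z) y (Z z)
            - (a ^ 2 * b ^ 2 / (4 * α ^ 2)) •
                (curv Γ z (X z) y (curv Γ z (Y z) y (Z z))
                  - curv Γ z (Y z) y (curv Γ z (Z z) y (X z))
                  - curv Γ z (Y z) y (curv Γ z (X z) y (Z z)))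
            + (a ^ 2 / (4 * α)) • curv Γ z (X z) (curv Γ z (Y z) y (Z z)) y
            - (b ^ 2 / α) • curv Γ z (X z) (Y z) (Z z)
            + (a * (a + c) / (2 * α)) • curv Γ z (X z) (Z z) (Y z)) := by
  have hd : ∀ {X : E → E}, ContDiffOn ℝ ∞ X Ω → ∀ {q : E × E}, q.1 ∈ Ω →
      DifferentiableAt ℝ X q.1 := fun hX q hq ↦
    (hX.contDiffAt (h.isOpen.mem_nhds hq)).differentiableAt (by simp)
  have hd' : ∀ {X : E → E}, ContDiffOn ℝ ∞ X Ω → ∀ {q : E × E}, q.1 ∈ Ω →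
      DifferentiableAt ℝ (fun q : E × E ↦ X q.1) q := fun hX q hq ↦
    (hd hX hq).comp q differentiableAt_fst
  have h0 : ∀ q : E × E, DifferentiableAt ℝ (fun _ : E × E ↦ (0 : E)) q := fun q ↦
    differentiableAt_const _
  have hs : ∀ q : E × E, DifferentiableAt ℝ (fun q : E × E ↦ q.2) q := fun q ↦
    differentiableAt_snd
  have hnhds : ∀ᶠ q : E × E in 𝓝 (z, y), q.1 ∈ Ω :=
    (h.isOpen.preimage continuous_fst).mem_nhds hz
  have hp : ((z, y) : E × E).1 ∈ Ω := hz
  have e1 : nabla Γ' (fun q ↦ lift Γ q 0 (Y q.1)) (fun q ↦ lift Γ q (Z q.1) 0) =ᶠ[𝓝 (z, y)]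
      fun q ↦ lift Γ q (-(a ^ 2 / (2 * α)) • curv Γ q.1 (Y q.1) q.2 (Z q.1))
        ((a * b / (2 * α)) • curv Γ q.1 (Y q.1) q.2 (Z q.1)) := by
    filter_upwards [hnhds] with q hq
    exact h.nabla_vertical_horizontal hq (hΓ' q hq) Y (hd hZ hq)
  have e2 : nabla Γ' (fun q ↦ lift Γ q (X q.1) 0) (fun q ↦ lift Γ q (Z q.1) 0) =ᶠ[𝓝 (z, y)]
      fun q ↦ lift Γ q (nabla Γ X Z q.1 + -(a * b / (2 * α)) •
        (curv Γ q.1 (X q.1) q.2 (Z q.1) + curv Γ q.1 (Z q.1) q.2 (X q.1)))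
        ((b ^ 2 / α) • curv Γ q.1 (X q.1) q.2 (Z q.1)
          - (a * (a + c) / (2 * α)) • curv Γ q.1 (X q.1) (Z q.1) q.2) := by
    filter_upwards [hnhds] with q hq
    exact h.nabla_horizontal_horizontal hq (hΓ' q hq) X (hd hZ hq)
  have e3 : nabla Γ' (fun q ↦ lift Γ q (X q.1) 0) (fun q ↦ lift Γ q 0 (Y q.1)) (z, y)
      - nabla Γ' (fun q ↦ lift Γ q 0 (Y q.1)) (fun q ↦ lift Γ q (X q.1) 0) (z, y)
      = lift Γ (z, y) 0 (nabla Γ X Y z) := by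
    rw [h.nabla_lift hp (hΓ' _ hp) (h0 _) (hd' hY hp),
      h.nabla_lift hp (hΓ' _ hp) (hd' hX hp) (h0 _), lift_sub,
      covAlong_comp_fst (X := X) (hd hY hp) (by simp), covAlong_zero, covAlong_zero,
      covAlong_comp_fst_of_vertical (hd hX hp) (by simp)]
    simp [corrH, corrV]
  have dN := hd' (contDiffOn_nabla h.isOpen h.contDiffOn hX hZ) hp
  have dYZ := h.differentiableAt_curv_along hp (hd' hY hp) (hs _) (hd' hZ hp)
  have dXZ := h.differentiableAt_curv_along hp (hd' hX hp) (hs _) (hd' hZ hp)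
  have dZX := h.differentiableAt_curv_along hp (hd' hZ hp) (hs _) (hd' hX hp)
  have dXZ' := h.differentiableAt_curv_along hp (hd' hX hp) (hd' hZ hp) (hs _)
  have e4 : nabla Γ' (fun q ↦ nabla Γ' (fun q ↦ lift Γ q (X q.1) 0) (fun q ↦ lift Γ q 0 (Y q.1)) q
        - nabla Γ' (fun q ↦ lift Γ q 0 (Y q.1)) (fun q ↦ lift Γ q (X q.1) 0) q)
        (fun q ↦ lift Γ q (Z q.1) 0) (z, y)
      = nabla Γ' (fun q ↦ lift Γ q 0 (nabla Γ X Y q.1)) (fun q ↦ lift Γ q (Z q.1) 0) (z, y) :=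
    nabla_congr rfl e3 Filter.EventuallyEq.rfl
  rw [nabla_congr rfl rfl e1, nabla_congr rfl rfl e2, e4]
  rw [h.nabla_lift hp (hΓ' _ hp) (dYZ.fun_const_smul _) (dYZ.fun_const_smul _),
    h.nabla_lift hp (hΓ' _ hp) (dN.fun_add ((dXZ.fun_add dZX).fun_const_smul _))
      ((dXZ.fun_const_smul _).fun_sub (dXZ'.fun_const_smul _)),
    h.nabla_lift hp (hΓ' _ hp) (hd' hZ hp) (h0 _), lift_sub, lift_sub]
  rw [covAlong_smul _ dYZ, covAlong_smul _ dYZ, covAlong_add dN ((dXZ.fun_add dZX).fun_const_smul _),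
    covAlong_smul _ (dXZ.fun_add dZX), covAlong_add dXZ dZX,
    covAlong_sub (dXZ.fun_const_smul _) (dXZ'.fun_const_smul _), covAlong_smul _ dXZ,
    covAlong_smul _ dXZ', covAlong_zero]
  simp only [h.covAlong_curv hp (hd' hY hp) (hs _) (hd' hZ hp),
    h.covAlong_curv hp (hd' hX hp) (hs _) (hd' hZ hp),
    h.covAlong_curv hp (hd' hZ hp) (hs _) (hd' hX hp),
    h.covAlong_curv hp (hd' hX hp) (hd' hZ hp) (hs _), covAlong_snd, vert_lift, lift_fst,
    nablaCurv_zero]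
  simp only [covAlong_comp_fst_of_vertical (Y := nabla Γ X Z) (hd (contDiffOn_nabla h.isOpen
      h.contDiffOn hX hZ) hp) (lift_fst Γ (z, y) 0 (Y z)),
    covAlong_comp_fst_of_vertical (hd hX hp) (lift_fst Γ (z, y) 0 (Y z)),
    covAlong_comp_fst_of_vertical (hd hZ hp) (lift_fst Γ (z, y) 0 (Y z)),
    covAlong_comp_fst_of_vertical (hd hZ hp) (lift_fst Γ (z, y) 0 (nabla Γ X Y z)),
    covAlong_comp_fst (X := X) (hd hY hp) (lift_fst Γ (z, y) (X z) 0),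
    covAlong_comp_fst (X := X) (hd hZ hp) (lift_fst Γ (z, y) (X z) 0)]
  simp only [corrH, corrV, map_zero, zero_apply, add_zero, zero_add, smul_zero, sub_zero, map_add,
    map_sub, map_smul, add_apply, sub_apply, smul_apply]
  have hb := h.curv_sub_curv hz (X z) y (curv Γ z (Y z) y (Z z))
  rw [sub_eq_iff_eq_add, ← sub_eq_iff_eq_add'] at hb
  simp only [← hb]
  congr 1
  · match_scalars <;> field_simp <;> ring
  · match_scalars <;> field_simp <;> first | ring1 | (rw [hα]; ring1)

end IsLeviCivitaOn

end LocalConnection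

namespace TangentChart

variable {E : Type*} [NormedAddCommGroup E] [NormedSpace ℝ E]
  {H : Type*} [TopologicalSpace H] {I : ModelWithCorners ℝ E H}
  {N : Type*} [TopologicalSpace N] [ChartedSpace H N] [IsManifold I ∞ N]

/-- The components of a tangent vector in the chart at `x₀`. -/
def comps (x₀ x : N) : TangentSpace I x →L[ℝ] E :=
  (trivializationAt E (TangentSpace I : N → Type _) x₀).continuousLinearMapAt ℝ x

/-- The tangent vector with given components in the chart at `x₀`. -/
def ofComps (x₀ x : N) : E →L[ℝ] TangentSpace I x :=
  (trivializationAt E (TangentSpace I : N → Type _) x₀).symmL ℝ x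

/-- The vector field with constant components in the chart at `x₀`. -/
def coordField (x₀ : N) (e : E) (x : N) : TangentSpace I x := ofComps x₀ x e

/-- The components of a vector field in the chart at `x₀`, as a function on the model space. -/
def rep (x₀ : N) (X : ∀ x : N, TangentSpace I x) (z : E) : E :=
  comps x₀ ((extChartAt I x₀).symm z) (X ((extChartAt I x₀).symm z))

variable {x₀ x : N}

lemma comps_ofComps (hx : x ∈ (extChartAt I x₀).source) (e : E) :
    comps (I := I) x₀ x (ofComps x₀ x e) = e :=
  (trivializationAt E (TangentSpace I : N → Type _) x₀).continuousLinearMapAt_symmL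
    (by simpa using hx) e

lemma ofComps_comps (hx : x ∈ (extChartAt I x₀).source) (u : TangentSpace I x) :
    ofComps x₀ x (comps x₀ x u) = u :=
  (trivializationAt E (TangentSpace I : N → Type _) x₀).symmL_continuousLinearMapAt
    (by simpa using hx) u

lemma comps_injective (hx : x ∈ (extChartAt I x₀).source) :
    Function.Injective (comps (I := I) x₀ x) :=
  Function.LeftInverse.injective (ofComps_comps hx)

lemma comps_eq_mfderiv (hx : x ∈ (extChartAt I x₀).source) (u : TangentSpace I x) :
    comps x₀ x u = mfderiv I 𝓘(ℝ, E) (extChartAt I x₀) x u := by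
  have := TangentBundle.continuousLinearMapAt_trivializationAt (I := I) (x₀ := x₀) (x := x)
    (by simpa using hx)
  exact DFunLike.congr_fun this u

lemma comps_eq_trivializationAt (hx : x ∈ (extChartAt I x₀).source) (u : TangentSpace I x) :
    comps x₀ x u = (trivializationAt E (TangentSpace I : N → Type _) x₀ ⟨x, u⟩).2 := by
  have hx' : x ∈ (trivializationAt E (TangentSpace I : N → Type _) x₀).baseSet := by
    simpa using hx
  rw [comps, Trivialization.continuousLinearMapAt_apply, Trivialization.linearMapAt_apply,
    if_pos hx']

lemma extend_apply (u : TangentSpace I x₀) (hx : x ∈ (extChartAt I x₀).source) :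
    (extend E u x : TangentSpace I x) = ofComps x₀ x (comps x₀ x₀ u) := by
  rw [comps_eq_trivializationAt (by simp), ofComps,
    Trivialization.symmL_apply _ (by simpa using hx)]
  rfl

lemma rep_apply (hx : x ∈ (extChartAt I x₀).source) (X : ∀ x : N, TangentSpace I x) :
    rep x₀ X (extChartAt I x₀ x) = comps x₀ x (X x) := by
  rw [rep, (extChartAt I x₀).left_inv hx]

lemma rep_coordField {z : E} (hz : z ∈ (extChartAt I x₀).target) (e : E) :
    rep (I := I) x₀ (coordField x₀ e) z = e :=
  comps_ofComps ((extChartAt I x₀).map_target hz) e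

lemma rep_extend (u : TangentSpace I x₀) {z : E} (hz : z ∈ (extChartAt I x₀).target) :
    rep x₀ (extend E u : ∀ y : N, TangentSpace I y) z = comps x₀ x₀ u := by
  rw [rep, extend_apply u ((extChartAt I x₀).map_target hz),
    comps_ofComps ((extChartAt I x₀).map_target hz)]

lemma mfderiv_eq {F : Type*} [NormedAddCommGroup F] [NormedSpace ℝ F] {f : N → F}
    (hx : x ∈ (extChartAt I x₀).source)
    (hf : DifferentiableAt ℝ (f ∘ (extChartAt I x₀).symm) (extChartAt I x₀ x))
    (v : TangentSpace I x) :
    (mfderiv I 𝓘(ℝ, F) f x v : F)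
      = fderiv ℝ (f ∘ (extChartAt I x₀).symm) (extChartAt I x₀ x) (comps x₀ x v) := by
  have hx' : x ∈ (chartAt H x₀).source := by simpa using hx
  have heq : f =ᶠ[𝓝 x] (f ∘ (extChartAt I x₀).symm) ∘ extChartAt I x₀ := by
    filter_upwards [(isOpen_extChartAt_source (I := I) x₀).mem_nhds hx] with y hy
    simp only [Function.comp_apply, (extChartAt I x₀).left_inv hy]
  rw [heq.mfderiv_eq, mfderiv_comp (I' := 𝓘(ℝ, E)) x hf.mdifferentiableAt
    (mdifferentiableAt_extChartAt hx'), mfderiv_eq_fderiv, comps_eq_mfderiv hx]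
  rfl

lemma mvfderiv_eq {F : Type*} [NormedAddCommGroup F] [NormedSpace ℝ F] {f : N → F}
    (hx : x ∈ (extChartAt I x₀).source)
    (hf : DifferentiableAt ℝ (f ∘ (extChartAt I x₀).symm) (extChartAt I x₀ x))
    (v : TangentSpace I x) :
    mvfderiv I f x v
      = fderiv ℝ (f ∘ (extChartAt I x₀).symm) (extChartAt I x₀ x) (comps x₀ x v) :=
  mfderiv_eq hx hf v

lemma contDiffOn_rep {X : ∀ x : N, TangentSpace I x}
    (hX : ContMDiff I I.tangent ∞ fun x ↦ (⟨x, X x⟩ : TangentBundle I N)) (x₀ : N) :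
    ContDiffOn ℝ ∞ (rep x₀ X) (extChartAt I x₀).target := by
  have h1 : ContMDiffOn I 𝓘(ℝ, E) ∞
      (fun x ↦ (trivializationAt E (TangentSpace I : N → Type _) x₀ ⟨x, X x⟩).2)
      (extChartAt I x₀).source := by
    rw [← (trivializationAt E (TangentSpace I : N → Type _) x₀).contMDiffOn_section_iff
      (isOpen_extChartAt_source x₀) (by simp)]
    exact hX.contMDiffOn
  have h2 := (h1.comp (contMDiffOn_extChartAt_symm x₀)
    (fun z hz ↦ (extChartAt I x₀).map_target hz)).contDiffOn
  refine h2.congr fun z hz ↦ ?_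
  rw [rep, comps_eq_trivializationAt ((extChartAt I x₀).map_target hz)]
  rfl

/-- A constant vector field on a normed space. -/
def constField (e : E) (z : E) : TangentSpace 𝓘(ℝ, E) z := e

lemma mdifferentiableAt_constField (e z : E) : MDiffAt (T% (constField e)) z :=
  ((contMDiffAt_vectorSpace_iff_contDiffAt (V := constField e) (n := 1)).2
    contDiffAt_const).mdifferentiableAt one_ne_zero

lemma mlieBracket_coordField [CompleteSpace E] (hx : x ∈ (extChartAt I x₀).source) (e f : E) :
    mlieBracket I (coordField (I := I) x₀ e) (coordField x₀ f) x = 0 := by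
  have key : ∀ e : E, coordField (I := I) x₀ e =ᶠ[𝓝 x]
      mpullback I 𝓘(ℝ, E) (extChartAt I x₀) (constField e) := by
    intro e
    filter_upwards [(isOpen_extChartAt_source (I := I) x₀).mem_nhds hx] with y hy
    have hinv := isInvertible_mfderiv_extChartAt (I := I) hy
    apply hinv.injective
    have h1 := hinv.self_apply_inverse (constField e (extChartAt I x₀ y))
    have h2 := comps_ofComps (I := I) hy e
    rw [comps_eq_mfderiv hy] at h2
    exact h2.trans h1.symm
  have : IsManifold I (minSmoothness ℝ 2) N := .of_le (n := ∞) (by simp; norm_cast)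
  rw [(key e).mlieBracket_vectorField_eq (key f)]
  rw [← mpullback_mlieBracket (n := ∞) (mdifferentiableAt_constField e _)
    (mdifferentiableAt_constField f _) (contMDiffAt_extChartAt' (by simpa using hx))
    (by simp; norm_cast)]
  have h0 : mlieBracket 𝓘(ℝ, E) (constField e) (constField f) (extChartAt I x₀ x) = 0 := by
    have h1 : lieBracketWithin ℝ (fun _ : E ↦ e) (fun _ ↦ f) Set.univ (extChartAt I x₀ x) = 0 := by
      simp [lieBracket]
    rw [← mlieBracketWithin_univ]
    exact (congrFun (mlieBracketWithin_eq_lieBracketWithin (V := constField e)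
      (W := constField f)) _).trans h1
  rw [mpullback_apply, h0, map_zero]

lemma contMDiffOn_coordField (x₀ : N) (e : E) :
    ContMDiffOn I I.tangent ∞ (fun x ↦ (⟨x, coordField x₀ e x⟩ : TangentBundle I N))
      (extChartAt I x₀).source := by
  have := (trivializationAt E (TangentSpace I : N → Type _) x₀).contMDiffOn_section_iff (IB := I)
      (n := ∞) (s := coordField (I := I) x₀ e) (isOpen_extChartAt_source (I := I) x₀) (by simp)
  refine this.2 (contMDiffOn_const (c := e) |>.congr fun x hx ↦ ?_)
  rw [← comps_eq_trivializationAt hx, coordField, comps_ofComps hx]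

lemma contDiffOn_rep_extend (u : TangentSpace I x₀) :
    ContDiffOn ℝ ∞ (rep x₀ (extend E u : ∀ y : N, TangentSpace I y)) (extChartAt I x₀).target :=
  contDiffOn_const.congr fun _ hz ↦ rep_extend u hz

variable [I.Boundaryless]

lemma mdifferentiableAt_iff {F : Type*} [NormedAddCommGroup F] [NormedSpace ℝ F] {f : N → F}
    (hx : x ∈ (extChartAt I x₀).source) :
    MDifferentiableAt I 𝓘(ℝ, F) f x ↔
      DifferentiableAt ℝ (f ∘ (extChartAt I x₀).symm) (extChartAt I x₀ x) := by
  have hx' : x ∈ (chartAt H x₀).source := by simpa using hx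
  have hz := (extChartAt I x₀).map_source hx
  constructor
  · intro hf
    rw [← mdifferentiableAt_iff_differentiableAt]
    have h1 := mdifferentiableWithinAt_extChartAt_symm (I := I) hz
    rw [I.range_eq_univ, mdifferentiableWithinAt_univ] at h1
    refine MDifferentiableAt.comp (I' := I) _ ?_ h1
    rwa [(extChartAt I x₀).left_inv hx]
  · intro hf
    rw [← mdifferentiableAt_iff_differentiableAt] at hf
    refine (MDifferentiableAt.comp (I' := 𝓘(ℝ, E)) x hf
      (mdifferentiableAt_extChartAt hx')).congr_of_eventuallyEq ?_
    filter_upwards [(isOpen_extChartAt_source (I := I) x₀).mem_nhds hx] with y hy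
    simp only [Function.comp_apply, (extChartAt I x₀).left_inv hy]

lemma mdifferentiableAt_field_iff (hx : x ∈ (extChartAt I x₀).source)
    {X : ∀ x : N, TangentSpace I x} :
    MDiffAt (T% X) x ↔ DifferentiableAt ℝ (rep x₀ X) (extChartAt I x₀ x) := by
  rw [(trivializationAt E (TangentSpace I : N → Type _) x₀).mdifferentiableAt_section_iff I X
    (by simpa using hx), mdifferentiableAt_iff hx]
  apply Filter.EventuallyEq.differentiableAt_iff
  filter_upwards [(isOpen_extChartAt_target (I := I) x₀).mem_nhds
    ((extChartAt I x₀).map_source hx)] with z hz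
  rw [rep, comps_eq_trivializationAt ((extChartAt I x₀).map_target hz)]
  rfl

lemma mdifferentiableAt_coordField (hx : x ∈ (extChartAt I x₀).source) (e : E) :
    MDiffAt (T% (coordField (I := I) x₀ e)) x := by
  rw [mdifferentiableAt_field_iff hx]
  refine (differentiableAt_const e).congr_of_eventuallyEq ?_
  filter_upwards [(isOpen_extChartAt_target (I := I) x₀).mem_nhds
    ((extChartAt I x₀).map_source hx)] with z hz
  exact rep_coordField hz e

end TangentChart

namespace LocalConnection

variable {E : Type*} [NormedAddCommGroup E] [NormedSpace ℝ E]

/-- The curvature tensor as a commutator of covariant derivatives. -/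
lemma nabla_nabla_sub {Ω : Set E} {Γ : E → E →L[ℝ] E →L[ℝ] E} (hΩ : IsOpen Ω)
    (hΓ : ContDiffOn ℝ ∞ Γ Ω) (hsymm : ∀ z ∈ Ω, ∀ u v, Γ z u v = Γ z v u) {X Y Z : E → E}
    (hX : ContDiffOn ℝ ∞ X Ω) (hY : ContDiffOn ℝ ∞ Y Ω) (hZ : ContDiffOn ℝ ∞ Z Ω) {z : E}
    (hz : z ∈ Ω) :
    nabla Γ X (nabla Γ Y Z) z - nabla Γ Y (nabla Γ X Z) z
      - nabla Γ (fun z ↦ nabla Γ X Y z - nabla Γ Y X z) Z z = curv Γ z (X z) (Y z) (Z z) := by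
  have hn := hΩ.mem_nhds hz
  have hd : ∀ {X : E → E}, ContDiffOn ℝ ∞ X Ω → HasFDerivAt X (fderiv ℝ X z) z := fun hX ↦
    ((hX.contDiffAt hn).differentiableAt (by simp)).hasFDerivAt
  have hΓd : HasFDerivAt Γ (fderiv ℝ Γ z) z :=
    ((hΓ.contDiffAt hn).differentiableAt (by simp)).hasFDerivAt
  have hZ2 : HasFDerivAt (fderiv ℝ Z) (fderiv ℝ (fderiv ℝ Z) z) z :=
    (((hZ.contDiffAt hn).fderiv_right (m := 1) (by norm_cast)).differentiableAt
      (by simp)).hasFDerivAt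
  have hsnd : IsSymmSndFDerivAt ℝ Z z :=
    (hZ.contDiffAt hn).isSymmSndFDerivAt (by simp; norm_cast)
  have key : ∀ {Y : E → E}, ContDiffOn ℝ ∞ Y Ω → ∀ u, fderiv ℝ (nabla Γ Y Z) z u
      = fderiv ℝ (fderiv ℝ Z) z u (Y z) + fderiv ℝ Z z (fderiv ℝ Y z u)
        + (fderiv ℝ Γ z u (Y z) (Z z) + Γ z (fderiv ℝ Y z u) (Z z)
          + Γ z (Y z) (fderiv ℝ Z z u)) := by
    intro Y hY u
    have h1 := (hZ2.clm_apply (hd hY)).add ((hΓd.clm_apply (hd hY)).clm_apply (hd hZ))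
    have h2 : fderiv ℝ (nabla Γ Y Z) z u = _ := DFunLike.congr_fun h1.fderiv u
    rw [h2]
    simp
    abel
  simp only [nabla] at key ⊢
  rw [key hY, key hX, hsnd (X z) (Y z), hsymm z hz (Y z) (X z), curv_apply]
  simp only [map_add, map_sub, add_apply, sub_apply]
  abel

end LocalConnection

namespace TangentChart

open LocalConnection

variable {E : Type*} [NormedAddCommGroup E] [NormedSpace ℝ E]
  {H : Type*} [TopologicalSpace H] {I : ModelWithCorners ℝ E H}
  {N : Type*} [TopologicalSpace N] [ChartedSpace H N] [IsManifold I ∞ N]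

variable {cov : CovariantDerivative I E (TangentSpace I : N → Type _)} {x₀ x : N}

lemma mdifferentiableAt_sum {ι : Type*} (s : Finset ι) {X : ι → ∀ x : N, TangentSpace I x}
    (hX : ∀ i, MDiffAt (T% (X i)) x) : MDiffAt (T% (∑ i ∈ s, X i)) x := by
  classical
  induction s using Finset.induction_on with
  | empty => simpa using! mdifferentiableAt_zeroSection ..
  | insert i s hi ih =>
    rw [Finset.sum_insert hi]
    exact mdifferentiableAt_add_section (hX i) ih

lemma cov_sum {ι : Type*} (s : Finset ι) {X : ι → ∀ x : N, TangentSpace I x}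
    (hX : ∀ i, MDiffAt (T% (X i)) x) : cov (∑ i ∈ s, X i) x = ∑ i ∈ s, cov (X i) x := by
  classical
  induction s using Finset.induction_on with
  | empty => simp
  | insert i s hi ih =>
    rw [Finset.sum_insert hi, Finset.sum_insert hi,
      cov.isCovariantDerivativeOnUniv.add (hX i) (mdifferentiableAt_sum s hX), ih]

variable [FiniteDimensional ℝ E]

/-- The Christoffel symbols at `x` of a covariant derivative in the chart at `x₀`. -/
def christoffelAt (cov : CovariantDerivative I E (TangentSpace I : N → Type _)) (x₀ x : N) :
    E →L[ℝ] E →L[ℝ] E :=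
  ∑ i, (((Module.finBasis ℝ E).coord i).toContinuousLinearMap.smulRight
    ((comps x₀ x).comp ((cov (coordField x₀ (Module.finBasis ℝ E i)) x).comp
      (ofComps x₀ x)))).flip

/-- The Christoffel symbols in the chart at `x₀`, as a function on the model space. -/
def christoffel (cov : CovariantDerivative I E (TangentSpace I : N → Type _)) (x₀ : N) (z : E) :
    E →L[ℝ] E →L[ℝ] E :=
  christoffelAt cov x₀ ((extChartAt I x₀).symm z)

lemma christoffel_apply (hx : x ∈ (extChartAt I x₀).source) (v : TangentSpace I x) (w : E) :
    christoffel cov x₀ (extChartAt I x₀ x) (comps x₀ x v) w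
      = ∑ i, (Module.finBasis ℝ E).coord i w •
          comps x₀ x (cov (coordField x₀ (Module.finBasis ℝ E i)) x v) := by
  rw [christoffel, (extChartAt I x₀).left_inv hx, christoffelAt]
  simp [sum_apply, ofComps_comps hx]

variable [I.Boundaryless]

/-- The covariant derivative in the chart at `x₀`. -/
lemma comps_cov (hx : x ∈ (extChartAt I x₀).source) {X : ∀ x : N, TangentSpace I x}
    (hX : MDiffAt (T% X) x) (v : TangentSpace I x) :
    comps x₀ x (cov X x v) = fderiv ℝ (rep x₀ X) (extChartAt I x₀ x) (comps x₀ x v)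
      + christoffel cov x₀ (extChartAt I x₀ x) (comps x₀ x v) (comps x₀ x (X x)) := by
  have hX' := (mdifferentiableAt_field_iff hx).1 hX
  let b := Module.finBasis ℝ E
  let f : Fin (Module.finrank ℝ E) → N → ℝ := fun i y ↦
    (b.coord i).toContinuousLinearMap (comps x₀ y (X y))
  have hfd : ∀ i, HasFDerivAt (f i ∘ (extChartAt I x₀).symm)
      ((b.coord i).toContinuousLinearMap.comp (fderiv ℝ (rep x₀ X) (extChartAt I x₀ x)))
      (extChartAt I x₀ x) := fun i ↦
    (b.coord i).toContinuousLinearMap.hasFDerivAt.comp _ hX'.hasFDerivAt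
  have hf : ∀ i, MDifferentiableAt I 𝓘(ℝ, ℝ) (f i) x := fun i ↦
    (mdifferentiableAt_iff hx).2 (hfd i).differentiableAt
  have hc := fun i ↦ mdifferentiableAt_coordField hx (b i)
  have hfc : ∀ i, MDiffAt (T% (f i • coordField (I := I) x₀ (b i))) x := fun i ↦
    (hf i).smul_section (hc i)
  have heq : ∀ᶠ y in 𝓝 x, X y = (∑ i, f i • coordField (I := I) x₀ (b i)) y := by
    filter_upwards [(isOpen_extChartAt_source (I := I) x₀).mem_nhds hx] with y hy
    apply comps_injective hy
    simp only [Finset.sum_apply, Pi.smul_apply', map_sum, map_smul, coordField, comps_ofComps hy]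
    exact (b.sum_repr _).symm
  rw [cov.isCovariantDerivativeOnUniv.congr_of_eventuallyEq hX
    (mdifferentiableAt_sum _ hfc) Filter.univ_mem heq, cov_sum _ hfc, christoffel_apply hx]
  simp only [fun i ↦ cov.isCovariantDerivativeOnUniv.leibniz (hc i) (hf i)]
  have hd : ∀ i, mvfderiv I (f i) x v
      = b.repr (fderiv ℝ (rep x₀ X) (extChartAt I x₀ x) (comps x₀ x v)) i := fun i ↦ by
    rw [mvfderiv_eq hx (hfd i).differentiableAt, (hfd i).fderiv]
    simp
  simp only [sum_apply, add_apply, smul_apply,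
    ContinuousLinearMap.smulRight_apply, map_sum, map_add, map_smul, hd,
    Finset.sum_add_distrib, coordField, comps_ofComps hx]
  rw [add_comm, b.sum_repr]
  rfl

lemma rep_nablaField {z : E} (hz : z ∈ (extChartAt I x₀).target) {X Y : ∀ x : N, TangentSpace I x}
    (hY : DifferentiableAt ℝ (rep x₀ Y) z) :
    rep x₀ (nablaField cov X Y) z = nabla (christoffel cov x₀) (rep x₀ X) (rep x₀ Y) z := by
  have hx := (extChartAt I x₀).map_target hz
  have hY' : MDiffAt (T% Y) ((extChartAt I x₀).symm z) := by
    rw [mdifferentiableAt_field_iff hx, (extChartAt I x₀).right_inv hz]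
    exact hY
  have h1 := comps_cov (cov := cov) hx hY' (X ((extChartAt I x₀).symm z))
  rw [(extChartAt I x₀).right_inv hz] at h1
  exact h1

lemma eventuallyEq_rep_nablaField {z : E} (hz : z ∈ (extChartAt I x₀).target)
    {X Y : ∀ x : N, TangentSpace I x}
    (hY : DifferentiableOn ℝ (rep x₀ Y) (extChartAt I x₀).target) :
    rep x₀ (nablaField cov X Y) =ᶠ[𝓝 z] nabla (christoffel cov x₀) (rep x₀ X) (rep x₀ Y) := by
  filter_upwards [(isOpen_extChartAt_target (I := I) x₀).mem_nhds hz] with z' hz'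
  exact rep_nablaField hz' (hY.differentiableAt
    ((isOpen_extChartAt_target (I := I) x₀).mem_nhds hz'))

lemma cov_coordField {z : E} (hz : z ∈ (extChartAt I x₀).target) (e u : E) :
    cov (coordField x₀ e) ((extChartAt I x₀).symm z) (ofComps x₀ ((extChartAt I x₀).symm z) u)
      = ofComps x₀ ((extChartAt I x₀).symm z) (christoffel cov x₀ z u e) := by
  have hx := (extChartAt I x₀).map_target hz
  have heq : rep (I := I) x₀ (coordField x₀ e) =ᶠ[𝓝 z] fun _ ↦ e := by
    filter_upwards [(isOpen_extChartAt_target (I := I) x₀).mem_nhds hz] with z' hz'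
    exact rep_coordField hz' e
  apply comps_injective hx
  rw [comps_cov hx (mdifferentiableAt_coordField hx e), (extChartAt I x₀).right_inv hz,
    heq.fderiv_eq, comps_ofComps hx, comps_ofComps hx, coordField, comps_ofComps hx]
  simp

section Torsion

variable [CompleteSpace E]

lemma rep_mlieBracket (hcov : cov.torsion = 0) {z : E} (hz : z ∈ (extChartAt I x₀).target)
    {X Y : ∀ x : N, TangentSpace I x}
    (hX : DifferentiableAt ℝ (rep x₀ X) z) (hY : DifferentiableAt ℝ (rep x₀ Y) z) :
    rep x₀ (mlieBracket I X Y) z = nabla (christoffel cov x₀) (rep x₀ X) (rep x₀ Y) z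
      - nabla (christoffel cov x₀) (rep x₀ Y) (rep x₀ X) z := by
  have hx := (extChartAt I x₀).map_target hz
  have hd : ∀ {Y : ∀ x : N, TangentSpace I x}, DifferentiableAt ℝ (rep x₀ Y) z →
      MDiffAt (T% Y) ((extChartAt I x₀).symm z) := fun hY ↦ by
    rw [mdifferentiableAt_field_iff hx, (extChartAt I x₀).right_inv hz]
    exact hY
  rw [← rep_nablaField hz hY, ← rep_nablaField hz hX]
  have h1 := cov.torsion_eq_zero_iff.1 hcov (hd hX) (hd hY)
  simp only [rep, nablaField]
  rw [← h1, map_sub]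

lemma christoffel_symm (hcov : cov.torsion = 0) {z : E} (hz : z ∈ (extChartAt I x₀).target) (e f : E) :
    christoffel cov x₀ z e f = christoffel cov x₀ z f e := by
  have hn := (isOpen_extChartAt_target (I := I) x₀).mem_nhds hz
  have heq : ∀ e : E, rep (I := I) x₀ (coordField x₀ e) =ᶠ[𝓝 z] fun _ ↦ e := fun e ↦ by
    filter_upwards [hn] with z' hz'
    exact rep_coordField hz' e
  have hd : ∀ e : E, DifferentiableAt ℝ (rep (I := I) x₀ (coordField x₀ e)) z := fun e ↦
    (differentiableAt_const e).congr_of_eventuallyEq (heq e)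
  have h1 := rep_mlieBracket hcov hz (hd e) (hd f)
  rw [rep, mlieBracket_coordField ((extChartAt I x₀).map_target hz), map_zero,
    nabla_congr (X' := fun _ ↦ e) rfl (heq e).eq_of_nhds (heq f),
    nabla_congr (X' := fun _ ↦ f) rfl (heq f).eq_of_nhds (heq e)]
    at h1
  simp only [nabla, fderiv_fun_const, Pi.zero_apply, zero_apply, zero_add] at h1
  exact (sub_eq_zero.1 h1.symm)

/-- The curvature in the chart at `x₀`, in terms of iterated covariant derivatives. -/
lemma rep_curvField (hcov : cov.torsion = 0) {z : E} (hz : z ∈ (extChartAt I x₀).target)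
    {X Y Z : ∀ x : N, TangentSpace I x}
    (hX : DifferentiableAt ℝ (rep x₀ X) z) (hY : DifferentiableAt ℝ (rep x₀ Y) z)
    (hZ : DifferentiableOn ℝ (rep x₀ Z) (extChartAt I x₀).target)
    (hYZ : DifferentiableAt ℝ (nabla (christoffel cov x₀) (rep x₀ Y) (rep x₀ Z)) z)
    (hXZ : DifferentiableAt ℝ (nabla (christoffel cov x₀) (rep x₀ X) (rep x₀ Z)) z) :
    rep x₀ (curvField cov X Y Z) z
      = nabla (christoffel cov x₀) (rep x₀ X)
          (nabla (christoffel cov x₀) (rep x₀ Y) (rep x₀ Z)) z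
        - nabla (christoffel cov x₀) (rep x₀ Y)
          (nabla (christoffel cov x₀) (rep x₀ X) (rep x₀ Z)) z
        - nabla (christoffel cov x₀) (fun z ↦
            nabla (christoffel cov x₀) (rep x₀ X) (rep x₀ Y) z
              - nabla (christoffel cov x₀) (rep x₀ Y) (rep x₀ X) z) (rep x₀ Z) z := by
  have hn := (isOpen_extChartAt_target (I := I) x₀).mem_nhds hz
  have eY := eventuallyEq_rep_nablaField (cov := cov) (X := Y) hz hZ
  have eX := eventuallyEq_rep_nablaField (cov := cov) (X := X) hz hZ
  have h1 := rep_nablaField (cov := cov) (X := X) hz (hYZ.congr_of_eventuallyEq eY)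
  have h2 := rep_nablaField (cov := cov) (X := Y) hz (hXZ.congr_of_eventuallyEq eX)
  have h3 := rep_nablaField (cov := cov) (X := mlieBracket I X Y) hz (hZ.differentiableAt hn)
  rw [nabla_congr rfl rfl eY] at h1
  rw [nabla_congr rfl rfl eX] at h2
  rw [← h1, ← h2]
  have h4 : nabla (christoffel cov x₀) (fun z ↦
            nabla (christoffel cov x₀) (rep x₀ X) (rep x₀ Y) z
              - nabla (christoffel cov x₀) (rep x₀ Y) (rep x₀ X) z) (rep x₀ Z) z
      = nabla (christoffel cov x₀) (rep x₀ (mlieBracket I X Y)) (rep x₀ Z) z :=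
    nabla_congr rfl (rep_mlieBracket hcov hz hX hY).symm Filter.EventuallyEq.rfl
  rw [h4, ← h3]
  simp only [rep, curvField, map_sub]

end Torsion

end TangentChart

namespace TangentChart

open LocalConnection

variable {E : Type*} [NormedAddCommGroup E] [NormedSpace ℝ E] [FiniteDimensional ℝ E]
  {H : Type*} [TopologicalSpace H] {I : ModelWithCorners ℝ E H}
  {N : Type*} [TopologicalSpace N] [ChartedSpace H N] [IsManifold I ∞ N]

/-- A Riemannian metric in the chart at `x₀`. -/
def metricRep (g : ContMDiffRiemannianMetric I ∞ E (TangentSpace I : N → Type _)) (x₀ : N) (z : E) :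
    E →L[ℝ] E →L[ℝ] ℝ :=
  LinearMap.toContinuousLinearMap
    { toFun e := (g.inner ((extChartAt I x₀).symm z) (ofComps x₀ _ e)).comp (ofComps x₀ _)
      map_add' e e' := by rw [map_add, map_add]; rfl
      map_smul' r e := by rw [map_smul, map_smul]; rfl }

lemma metricRep_apply (g : ContMDiffRiemannianMetric I ∞ E (TangentSpace I : N → Type _)) (x₀ : N)
    (z e f : E) : metricRep g x₀ z e f = g.inner ((extChartAt I x₀).symm z)
      (ofComps x₀ ((extChartAt I x₀).symm z) e) (ofComps x₀ ((extChartAt I x₀).symm z) f) := rfl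

lemma inner_eq_metricRep (g : ContMDiffRiemannianMetric I ∞ E (TangentSpace I : N → Type _))
    {x₀ x : N} (hx : x ∈ (extChartAt I x₀).source) (u v : TangentSpace I x) :
    g.inner x u v = metricRep g x₀ (extChartAt I x₀ x) (comps x₀ x u) (comps x₀ x v) := by
  rw [metricRep_apply, (extChartAt I x₀).left_inv hx, ofComps_comps hx, ofComps_comps hx]

lemma contDiffOn_metricRep (g : ContMDiffRiemannianMetric I ∞ E (TangentSpace I : N → Type _))
    (x₀ : N) : ContDiffOn ℝ ∞ (metricRep g x₀) (extChartAt I x₀).target := by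
  refine contDiffOn_clm_apply.2 fun e ↦ contDiffOn_clm_apply.2 fun f ↦ ?_
  have h1 : ContMDiffOn I (I.prod 𝓘(ℝ, ℝ)) ∞
      (fun x ↦ TotalSpace.mk' ℝ (E := Bundle.Trivial N ℝ) x
        (g.inner x (coordField x₀ e x) (coordField x₀ f x))) (extChartAt I x₀).source := by
    apply ContMDiffOn.clm_bundle_apply₂ (F₁ := E) (F₂ := E)
    · exact g.contMDiff.contMDiffOn
    · exact contMDiffOn_coordField x₀ e
    · exact contMDiffOn_coordField x₀ f
  have h2 : ContMDiffOn I 𝓘(ℝ, ℝ) ∞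
      (fun x ↦ g.inner x (coordField x₀ e x) (coordField x₀ f x)) (extChartAt I x₀).source := by
    intro x hx
    have h3 := h1 x hx
    rw [contMDiffWithinAt_totalSpace] at h3
    exact h3.2
  exact (h2.comp (contMDiffOn_extChartAt_symm x₀)
    (fun z hz ↦ (extChartAt I x₀).map_target hz)).contDiffOn

variable [CompleteSpace E] [I.Boundaryless]
  {g : ContMDiffRiemannianMetric I ∞ E (TangentSpace I : N → Type _)}
  {cov : CovariantDerivative I E (TangentSpace I : N → Type _)} {x₀ : N}

/-- Compatibility with the metric in the chart at `x₀`. -/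
lemma fderiv_metric {G : ∀ x : N, TangentSpace I x → TangentSpace I x → ℝ}
    (hG : IsLeviCivita G cov) {z : E} (hz : z ∈ (extChartAt I x₀).target) (e f : E)
    (hd : DifferentiableAt ℝ (fun z ↦ G ((extChartAt I x₀).symm z)
      (ofComps x₀ ((extChartAt I x₀).symm z) e) (ofComps x₀ ((extChartAt I x₀).symm z) f)) z)
    (u : E) :
    fderiv ℝ (fun z ↦ G ((extChartAt I x₀).symm z)
      (ofComps x₀ ((extChartAt I x₀).symm z) e) (ofComps x₀ ((extChartAt I x₀).symm z) f)) z u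
      = G ((extChartAt I x₀).symm z)
          (ofComps x₀ ((extChartAt I x₀).symm z) (christoffel cov x₀ z u e))
          (ofComps x₀ ((extChartAt I x₀).symm z) f)
        + G ((extChartAt I x₀).symm z) (ofComps x₀ ((extChartAt I x₀).symm z) e)
          (ofComps x₀ ((extChartAt I x₀).symm z) (christoffel cov x₀ z u f)) := by
  have hx := (extChartAt I x₀).map_target hz
  have h1 := hG.metric ((extChartAt I x₀).symm z) (coordField x₀ u) (coordField x₀ e)
    (coordField x₀ f) (mdifferentiableAt_coordField hx u) (mdifferentiableAt_coordField hx e)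
    (mdifferentiableAt_coordField hx f)
  have hr := (extChartAt I x₀).right_inv hz
  have h2 := mvfderiv_eq (f := fun x ↦ G x (coordField x₀ e x) (coordField x₀ f x)) hx
    (by rw [hr]; exact hd) (coordField x₀ u ((extChartAt I x₀).symm z))
  rw [h1, hr] at h2
  simp only [coordField, comps_ofComps hx] at h2
  rw [← cov_coordField hz, ← cov_coordField hz]
  exact h2.symm

lemma isLeviCivitaOn (hcov : IsLeviCivita (fun x u v ↦ g.inner x u v) cov) (x₀ : N) :
    IsLeviCivitaOn (extChartAt I x₀).target (metricRep g x₀) (christoffel cov x₀) where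
  isOpen := isOpen_extChartAt_target x₀
  contDiffOn_metric := contDiffOn_metricRep g x₀
  symm_metric z hz u v := g.symm _ _ _
  pos_metric z hz u hu := by
    refine g.pos _ _ fun h ↦ hu ?_
    rw [← comps_ofComps (I := I) ((extChartAt I x₀).map_target hz) u, h, map_zero]
  symm z hz u v := christoffel_symm hcov.torsion_eq_zero hz u v
  compat z hz s u v := by
    have hd : DifferentiableAt ℝ (metricRep g x₀) z :=
      ((contDiffOn_metricRep g x₀).contDiffAt
        ((isOpen_extChartAt_target x₀).mem_nhds hz)).differentiableAt (by simp)
    have h1 : HasFDerivAt (fun z ↦ metricRep g x₀ z u v) _ z :=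
      (hd.hasFDerivAt.clm_apply (hasFDerivAt_const u z)).clm_apply (hasFDerivAt_const v z)
    have h2 := fderiv_metric hcov hz u v h1.differentiableAt s
    have h3 : fderiv ℝ (fun z ↦ metricRep g x₀ z u v) z s = fderiv ℝ (metricRep g x₀) z s u v := by
      rw [h1.fderiv]; simp
    rw [← h3]
    exact h2

/-- The curvature of smooth vector fields in the chart at `x₀`. -/
lemma rep_curvField_eq_curv (hcov : IsLeviCivita (fun x u v ↦ g.inner x u v) cov)
    {X Y Z : ∀ x : N, TangentSpace I x}
    (hX : ContDiffOn ℝ ∞ (rep x₀ X) (extChartAt I x₀).target)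
    (hY : ContDiffOn ℝ ∞ (rep x₀ Y) (extChartAt I x₀).target)
    (hZ : ContDiffOn ℝ ∞ (rep x₀ Z) (extChartAt I x₀).target)
    {z : E} (hz : z ∈ (extChartAt I x₀).target) :
    rep x₀ (curvField cov X Y Z) z
      = curv (christoffel cov x₀) z (rep x₀ X z) (rep x₀ Y z) (rep x₀ Z z) := by
  have h := isLeviCivitaOn hcov x₀
  have hd : ∀ {X : E → E}, ContDiffOn ℝ ∞ X (extChartAt I x₀).target → DifferentiableAt ℝ X z :=
    fun hX ↦ (hX.contDiffAt (h.isOpen.mem_nhds hz)).differentiableAt (by simp)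
  rw [rep_curvField hcov.torsion_eq_zero hz (hd hX) (hd hY) (hZ.differentiableOn (by simp))
    (hd (contDiffOn_nabla h.isOpen h.contDiffOn hY hZ))
    (hd (contDiffOn_nabla h.isOpen h.contDiffOn hX hZ)),
    nabla_nabla_sub h.isOpen h.contDiffOn h.symm hX hY hZ hz]

lemma curvAt_eq (hcov : IsLeviCivita (fun x u v ↦ g.inner x u v) cov)
    (u v w : TangentSpace I x₀) :
    comps x₀ x₀ (curvAt cov u v w) = curv (christoffel cov x₀) (extChartAt I x₀ x₀)
      (comps x₀ x₀ u) (comps x₀ x₀ v) (comps x₀ x₀ w) := by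
  have hz := mem_extChartAt_target (I := I) x₀
  have h1 := rep_curvField_eq_curv hcov (contDiffOn_rep_extend u) (contDiffOn_rep_extend v)
    (contDiffOn_rep_extend w) hz
  rw [rep_extend u hz, rep_extend v hz, rep_extend w hz, rep_apply (by simp)] at h1
  exact h1

lemma nablaCurvAt_eq (hcov : IsLeviCivita (fun x u v ↦ g.inner x u v) cov)
    (s u v w : TangentSpace I x₀) :
    comps x₀ x₀ (nablaCurvAt cov s u v w) = nablaCurv (christoffel cov x₀) (extChartAt I x₀ x₀)
      (comps x₀ x₀ s) (comps x₀ x₀ u) (comps x₀ x₀ v) (comps x₀ x₀ w) := by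
  have hz := mem_extChartAt_target (I := I) x₀
  have h := isLeviCivitaOn hcov x₀
  have hn := h.isOpen.mem_nhds hz
  have hs := contDiffOn_rep_extend (I := I) (x₀ := x₀)
  have hN : ∀ u : TangentSpace I x₀, ∀ z ∈ (extChartAt I x₀).target,
      rep x₀ (nablaField cov (extend E s) (extend E u)) z
        = christoffel cov x₀ z (comps x₀ x₀ s) (comps x₀ x₀ u) := by
    intro u z hz
    have heq : rep x₀ (extend E u : ∀ y : N, TangentSpace I y) =ᶠ[𝓝 z]
        fun _ ↦ comps x₀ x₀ u := by
      filter_upwards [h.isOpen.mem_nhds hz] with z' hz'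
      exact rep_extend u hz'
    rw [rep_nablaField hz (((hs u).contDiffAt (h.isOpen.mem_nhds hz)).differentiableAt (by simp)),
      nabla, heq.fderiv_eq, rep_extend u hz, rep_extend s hz]
    simp
  have hN' : ∀ u : TangentSpace I x₀,
      ContDiffOn ℝ ∞ (rep x₀ (nablaField cov (extend E s) (extend E u)))
        (extChartAt I x₀).target := fun u ↦
    ((h.contDiffOn.clm_apply contDiffOn_const).clm_apply contDiffOn_const).congr (hN u)
  have heq : rep x₀ (curvField cov (extend E u) (extend E v) (extend E w))
      =ᶠ[𝓝 (extChartAt I x₀ x₀)]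
      fun z ↦ curv (christoffel cov x₀) z (comps x₀ x₀ u) (comps x₀ x₀ v) (comps x₀ x₀ w) := by
    filter_upwards [hn] with z hz
    rw [rep_curvField_eq_curv hcov (hs u) (hs v) (hs w) hz, rep_extend u hz, rep_extend v hz,
      rep_extend w hz]
  have hD : HasFDerivAt (fun z ↦ curv (christoffel cov x₀) z (comps x₀ x₀ u) (comps x₀ x₀ v)
      (comps x₀ x₀ w)) _ (extChartAt I x₀ x₀) :=
    (((h.differentiableAt_curv hz).hasFDerivAt.clm_apply (hasFDerivAt_const _ _)).clm_apply
      (hasFDerivAt_const _ _)).clm_apply (hasFDerivAt_const _ _)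
  have e1 : rep x₀ (nablaField cov (extend E s)
      (curvField cov (extend E u) (extend E v) (extend E w))) (extChartAt I x₀ x₀)
      = fderiv ℝ (curv (christoffel cov x₀)) (extChartAt I x₀ x₀) (comps x₀ x₀ s)
          (comps x₀ x₀ u) (comps x₀ x₀ v) (comps x₀ x₀ w)
        + christoffel cov x₀ (extChartAt I x₀ x₀) (comps x₀ x₀ s)
          (curv (christoffel cov x₀) (extChartAt I x₀ x₀) (comps x₀ x₀ u) (comps x₀ x₀ v)
            (comps x₀ x₀ w)) := by
    rw [rep_nablaField hz (hD.differentiableAt.congr_of_eventuallyEq heq),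
      nabla_congr (X' := fun _ ↦ comps x₀ x₀ s) rfl (rep_extend s hz) heq, nabla, hD.fderiv]
    simp
  have hx := mem_extChartAt_source (I := I) x₀
  simp only [nablaCurvAt, nablaCurvField, map_sub, ← rep_apply hx, e1]
  rw [rep_curvField_eq_curv hcov (hN' u) (hs v) (hs w) hz,
    rep_curvField_eq_curv hcov (hs u) (hN' v) (hs w) hz,
    rep_curvField_eq_curv hcov (hs u) (hs v) (hN' w) hz, hN u _ hz, hN v _ hz, hN w _ hz,
    rep_extend u hz, rep_extend v hz, rep_extend w hz]
  rfl

end TangentChart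

namespace TangentChart

open LocalConnection

variable {E : Type*} [NormedAddCommGroup E] [NormedSpace ℝ E]
  {H : Type*} [TopologicalSpace H] {I : ModelWithCorners ℝ E H}
  {M : Type*} [TopologicalSpace M] [ChartedSpace H M] [IsManifold I ∞ M]
  {p₀ p : TangentBundle I M}

lemma extChartAt_tangent_source (p₀ : TangentBundle I M) :
    (extChartAt I.tangent p₀).source = (fun p ↦ p.proj) ⁻¹' (extChartAt I p₀.proj).source := by
  ext p
  simp

lemma extChartAt_tangent_apply (hp : p.proj ∈ (extChartAt I p₀.proj).source) :
    extChartAt I.tangent p₀ p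
      = (extChartAt I p₀.proj p.proj, comps p₀.proj p.proj p.snd) := by
  rw [FiberBundle.extChartAt, comps_eq_trivializationAt hp]
  rfl

lemma extChartAt_tangent_symm_apply {q : E × E} (hq : q.1 ∈ (extChartAt I p₀.proj).target) :
    (extChartAt I.tangent p₀).symm q
      = ⟨(extChartAt I p₀.proj).symm q.1, ofComps p₀.proj ((extChartAt I p₀.proj).symm q.1) q.2⟩ := by
  have hx := (extChartAt I p₀.proj).map_target hq
  set p : TangentBundle I M :=
    ⟨(extChartAt I p₀.proj).symm q.1, ofComps p₀.proj ((extChartAt I p₀.proj).symm q.1) q.2⟩ with hp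
  have h1 : extChartAt I.tangent p₀ p = q := by
    rw [extChartAt_tangent_apply hx]
    ext
    · exact (extChartAt I p₀.proj).right_inv hq
    · exact comps_ofComps hx q.2
  rw [← h1, (extChartAt I.tangent p₀).left_inv]
  rw [extChartAt_tangent_source]
  exact hx

lemma extChartAt_tangent_target (p₀ : TangentBundle I M) :
    (extChartAt I.tangent p₀).target = (extChartAt I p₀.proj).target ×ˢ Set.univ := by
  ext q
  rw [Set.mem_prod]
  refine ⟨fun hq ↦ ⟨?_, trivial⟩, fun hq ↦ ?_⟩
  · have hs := (extChartAt I.tangent p₀).map_target hq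
    rw [extChartAt_tangent_source] at hs
    rw [← (extChartAt I.tangent p₀).right_inv hq, extChartAt_tangent_apply hs]
    exact (extChartAt I p₀.proj).map_source hs
  · have hx := (extChartAt I p₀.proj).map_target hq.1
    have h1 : extChartAt I.tangent p₀ ⟨(extChartAt I p₀.proj).symm q.1,
        ofComps p₀.proj ((extChartAt I p₀.proj).symm q.1) q.2⟩ = q := by
      rw [extChartAt_tangent_apply hx]
      ext
      · exact (extChartAt I p₀.proj).right_inv hq.1
      · exact comps_ofComps hx q.2
    rw [← h1]
    apply (extChartAt I.tangent p₀).map_source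
    rw [extChartAt_tangent_source]
    exact hx

lemma symm_mem_source (p₀ : TangentBundle I M) {q : E × E}
    (hq : q.1 ∈ (extChartAt I p₀.proj).target) :
    q ∈ (extChartAt I.tangent p₀).target ∧
    ((extChartAt I.tangent p₀).symm q).proj ∈ (extChartAt I p₀.proj).source ∧
    extChartAt I p₀.proj ((extChartAt I.tangent p₀).symm q).proj = q.1 := by
  have hq' : q ∈ (extChartAt I.tangent p₀).target := by
    rw [extChartAt_tangent_target]; exact ⟨hq, trivial⟩
  refine ⟨hq', ?_, ?_⟩
  · rw [extChartAt_tangent_symm_apply hq]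
    exact (extChartAt I p₀.proj).map_target hq
  · rw [extChartAt_tangent_symm_apply hq]
    exact (extChartAt I p₀.proj).right_inv hq

lemma comps_castTangent {q p p₀ : TangentBundle I M} (h : q = p) (ξ : TangentSpace I.tangent q) :
    comps p₀ p (castTangent h ξ) = comps p₀ q ξ := by
  subst h
  rfl

/-- The components of the velocity of a map into the tangent bundle. -/
lemma comps_mfderiv {F : Type*} [NormedAddCommGroup F] [NormedSpace ℝ F]
    {G : Type*} [TopologicalSpace G] {J : ModelWithCorners ℝ F G}
    {N : Type*} [TopologicalSpace N] [ChartedSpace G N] {f : N → TangentBundle I M} {y : N}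
    (hf : MDifferentiableAt J I.tangent f y)
    (hy : (f y).proj ∈ (extChartAt I p₀.proj).source) (v : TangentSpace J y) :
    comps p₀ (f y) (mfderiv J I.tangent f y v)
      = mfderiv J 𝓘(ℝ, E × E) (extChartAt I.tangent p₀ ∘ f) y v := by
  have hy' : f y ∈ (extChartAt I.tangent p₀).source := by
    rw [extChartAt_tangent_source]; exact hy
  rw [comps_eq_mfderiv hy', mfderiv_comp y (mdifferentiableAt_extChartAt (by simpa using hy')) hf]
  rfl

lemma comps_vlift (hp : p.proj ∈ (extChartAt I p₀.proj).source) (w : TangentSpace I p.proj) :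
    comps p₀ p (vlift p w) = (0, comps p₀.proj p.proj w) := by
  have hc : MDifferentiableAt 𝓘(ℝ, ℝ) I.tangent
      (fun s : ℝ ↦ (⟨p.proj, p.snd + s • w⟩ : TangentBundle I M)) 0 := by
    rw [mdifferentiableAt_totalSpace]
    refine ⟨mdifferentiableAt_const, ?_⟩
    have : ∀ s : ℝ, (trivializationAt E (TangentSpace I : M → Type _) p.proj
        (⟨p.proj, p.snd + s • w⟩ : TangentBundle I M)).2
        = comps p.proj p.proj p.snd + s • comps p.proj p.proj w := fun s ↦ by
      rw [← comps_eq_trivializationAt (by simp), map_add, map_smul]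
    simp only [this]
    rw [mdifferentiableAt_iff_differentiableAt]
    fun_prop
  have heq : extChartAt I.tangent p₀ ∘ (fun s : ℝ ↦ (⟨p.proj, p.snd + s • w⟩ : TangentBundle I M))
      = fun s : ℝ ↦ (extChartAt I p₀.proj p.proj,
        comps p₀.proj p.proj p.snd + s • comps p₀.proj p.proj w) := by
    funext s
    rw [Function.comp_apply, extChartAt_tangent_apply (by exact hp), map_add, map_smul]
  have hd : HasFDerivAt (fun s : ℝ ↦ (extChartAt I p₀.proj p.proj,
        comps p₀.proj p.proj p.snd + s • comps p₀.proj p.proj w)) _ 0 :=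
    (hasFDerivAt_const _ _).prodMk
      (((hasFDerivAt_id (𝕜 := ℝ) (0 : ℝ)).smul_const (comps p₀.proj p.proj w)).const_add _)
  rw [vlift, comps_castTangent]
  refine (comps_mfderiv hc hp _).trans ?_
  rw [heq, mfderiv_eq_fderiv, hd.fderiv]
  exact Prod.ext rfl (one_smul ℝ (comps p₀.proj p.proj w))

lemma comps_dproj (hp : p.proj ∈ (extChartAt I p₀.proj).source) (ξ : TangentSpace I.tangent p) :
    comps p₀.proj p.proj (dproj p ξ) = (comps p₀ p ξ).1 := by
  have hp' : p ∈ (extChartAt I.tangent p₀).source := by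
    rw [extChartAt_tangent_source]; exact hp
  have hΦ : MDifferentiableAt I.tangent 𝓘(ℝ, E × E) (extChartAt I.tangent p₀) p :=
    mdifferentiableAt_extChartAt (by simpa using hp')
  have h1 : mfderiv I.tangent 𝓘(ℝ, E) (extChartAt I p₀.proj ∘ fun q : TangentBundle I M ↦ q.proj) p
      = (mfderiv I 𝓘(ℝ, E) (extChartAt I p₀.proj) p.proj).comp
        (mfderiv I.tangent I (fun q : TangentBundle I M ↦ q.proj) p) :=
    mfderiv_comp p (mdifferentiableAt_extChartAt (by simpa using hp)) (mdifferentiableAt_proj _)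
  have h2 : mfderiv I.tangent 𝓘(ℝ, E) (Prod.fst ∘ extChartAt I.tangent p₀) p
      = (mfderiv 𝓘(ℝ, E × E) 𝓘(ℝ, E) Prod.fst (extChartAt I.tangent p₀ p)).comp
        (mfderiv I.tangent 𝓘(ℝ, E × E) (extChartAt I.tangent p₀) p) :=
    mfderiv_comp p differentiableAt_fst.mdifferentiableAt hΦ
  have heq : (extChartAt I p₀.proj ∘ fun q : TangentBundle I M ↦ q.proj)
      =ᶠ[𝓝 p] Prod.fst ∘ extChartAt I.tangent p₀ := by
    filter_upwards [(isOpen_extChartAt_source (I := I.tangent) p₀).mem_nhds hp'] with q hq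
    rw [extChartAt_tangent_source] at hq
    rw [Function.comp_apply, Function.comp_apply, extChartAt_tangent_apply hq]
  rw [heq.mfderiv_eq, h2] at h1
  rw [comps_eq_mfderiv hp, comps_eq_mfderiv hp']
  have h3 := DFunLike.congr_fun h1 ξ
  rw [mfderiv_eq_fderiv, fderiv_fst] at h3
  exact h3.symm

variable [FiniteDimensional ℝ E] [I.Boundaryless]
  {cov : CovariantDerivative I E (TangentSpace I : M → Type _)}

lemma comps_hlift (hp : p.proj ∈ (extChartAt I p₀.proj).source) (u : TangentSpace I p.proj) :
    comps p₀ p (hlift cov p u)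
      = lift (christoffel cov p₀.proj) (extChartAt I.tangent p₀ p)
          (comps p₀.proj p.proj u) 0 := by
  have hσ : MDiffAt (T% (extend E p.snd : ∀ y : M, TangentSpace I y)) p.proj :=
    mdifferentiableAt_extend I E p.snd
  have hrep := (mdifferentiableAt_field_iff hp).1 hσ
  have hd : HasFDerivAt (fun z ↦ (z, rep p₀.proj (extend E p.snd : ∀ y : M, TangentSpace I y) z)) _
      (extChartAt I p₀.proj p.proj) := (hasFDerivAt_id _).prodMk hrep.hasFDerivAt
  have heq : ((extChartAt I.tangent p₀ ∘
      fun x ↦ (⟨x, extend E p.snd x⟩ : TangentBundle I M)) ∘ (extChartAt I p₀.proj).symm)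
      =ᶠ[𝓝 (extChartAt I p₀.proj p.proj)]
      fun z ↦ (z, rep p₀.proj (extend E p.snd : ∀ y : M, TangentSpace I y) z) := by
    filter_upwards [(isOpen_extChartAt_target (I := I) p₀.proj).mem_nhds
      ((extChartAt I p₀.proj).map_source hp)] with z hz
    rw [Function.comp_apply, Function.comp_apply,
      extChartAt_tangent_apply ((extChartAt I p₀.proj).map_target hz)]
    exact Prod.ext ((extChartAt I p₀.proj).right_inv hz) rfl
  have h1 : comps p₀ p (castTangent (by simp) (mfderiv I I.tangent
      (fun x ↦ (⟨x, extend E p.snd x⟩ : TangentBundle I M)) p.proj u))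
      = (comps p₀.proj p.proj u, fderiv ℝ (rep p₀.proj (extend E p.snd : ∀ y : M, TangentSpace I y))
          (extChartAt I p₀.proj p.proj) (comps p₀.proj p.proj u)) := by
    rw [comps_castTangent]
    refine (comps_mfderiv hσ hp u).trans ?_
    refine (mfderiv_eq hp (hd.differentiableAt.congr_of_eventuallyEq heq) u).trans ?_
    rw [heq.fderiv_eq, hd.fderiv]
    rfl
  rw [hlift, map_sub, h1, comps_vlift hp, comps_cov hp hσ, extend_apply_self,
    extChartAt_tangent_apply hp, lift]
  ext
  · simp
  · simp

lemma exists_eq_hlift_add_vlift (cov : CovariantDerivative I E (TangentSpace I : M → Type _))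
    (hp : p.proj ∈ (extChartAt I p₀.proj).source) (ξ : TangentSpace I.tangent p) :
    ξ = hlift cov p (ofComps p₀.proj p.proj (comps p₀ p ξ).1)
      + vlift p (ofComps p₀.proj p.proj (vert (christoffel cov p₀.proj)
        (extChartAt I.tangent p₀ p) (comps p₀ p ξ))) := by
  have hp' : p ∈ (extChartAt I.tangent p₀).source := by
    rw [extChartAt_tangent_source]; exact hp
  apply comps_injective hp'
  rw [map_add, comps_hlift hp, comps_vlift hp, comps_ofComps hp, comps_ofComps hp]
  ext
  · simp [lift]
  · simp [lift, vert]

lemma connMap_self (ξ : TangentSpace I.tangent p) :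
    comps p.proj p.proj (connMap cov p ξ)
      = vert (christoffel cov p.proj) (extChartAt I.tangent p p) (comps p p ξ) := by
  have hx := mem_extChartAt_source (I := I) p.proj
  have hp' := mem_extChartAt_source (I := I.tangent) p
  have hΦ : MDifferentiableAt I.tangent 𝓘(ℝ, E × E) (extChartAt I.tangent p) p :=
    mdifferentiableAt_extChartAt (by simp)
  have h1 : mvfderiv I.tangent (fun q : TangentBundle I M ↦
        (trivializationAt E (TangentSpace I : M → Type _) p.proj q).2) p ξ = (comps p p ξ).2 := by
    have h2 : mfderiv I.tangent 𝓘(ℝ, E) (Prod.snd ∘ extChartAt I.tangent p) p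
        = (mfderiv 𝓘(ℝ, E × E) 𝓘(ℝ, E) Prod.snd (extChartAt I.tangent p p)).comp
          (mfderiv I.tangent 𝓘(ℝ, E × E) (extChartAt I.tangent p) p) :=
      mfderiv_comp p differentiableAt_snd.mdifferentiableAt hΦ
    have heq : (fun q : TangentBundle I M ↦
        (trivializationAt E (TangentSpace I : M → Type _) p.proj q).2)
        = Prod.snd ∘ extChartAt I.tangent p := by
      rw [FiberBundle.extChartAt]
      rfl
    rw [heq, comps_eq_mfderiv hp']
    rw [mfderiv_eq_fderiv, fderiv_snd] at h2
    exact DFunLike.congr_fun h2 ξ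
  have hσ : MDiffAt (T% (extend E p.snd : ∀ y : M, TangentSpace I y)) p.proj :=
    mdifferentiableAt_extend I E p.snd
  have h3 : fderiv ℝ (rep p.proj (extend E p.snd : ∀ y : M, TangentSpace I y))
      (extChartAt I p.proj p.proj) = 0 := by
    have heq : rep p.proj (extend E p.snd : ∀ y : M, TangentSpace I y)
        =ᶠ[𝓝 (extChartAt I p.proj p.proj)] fun _ ↦ comps p.proj p.proj p.snd := by
      filter_upwards [extChartAt_target_mem_nhds (I := I) p.proj] with z hz
      exact rep_extend p.snd hz
    rw [heq.fderiv_eq]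
    simp
  rw [connMap, h1, map_add, comps_cov hx hσ, h3, comps_dproj hx, extend_apply_self,
    extChartAt_tangent_apply hx, vert]
  have h4 : ∀ e : E, comps (I := I) p.proj p.proj
      ((trivializationAt E (TangentSpace I : M → Type _) p.proj).symm p.proj e) = e := fun e ↦ by
    rw [← Trivialization.symmL_apply (R := ℝ) _ (by simp)]
    exact comps_ofComps hx e
  rw [h4]
  simp

lemma connMap_add (ξ η : TangentSpace I.tangent p) :
    connMap cov p (ξ + η) = connMap cov p ξ + connMap cov p η := by
  apply comps_injective (mem_extChartAt_source (I := I) p.proj)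
  rw [map_add, connMap_self, connMap_self, connMap_self, map_add]
  simp only [vert, Prod.snd_add, Prod.fst_add, map_add, add_apply]
  abel

lemma connMap_hlift (u : TangentSpace I p.proj) : connMap cov p (hlift cov p u) = 0 := by
  have hx := mem_extChartAt_source (I := I) p.proj
  apply comps_injective hx
  rw [connMap_self, comps_hlift hx, vert_lift, map_zero]

lemma connMap_vlift (w : TangentSpace I p.proj) : connMap cov p (vlift p w) = w := by
  have hx := mem_extChartAt_source (I := I) p.proj
  apply comps_injective hx
  rw [connMap_self, comps_vlift hx, vert]
  simp

/-- The connection map in the chart at `p₀`. -/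
lemma comps_connMap (hp : p.proj ∈ (extChartAt I p₀.proj).source)
    (ξ : TangentSpace I.tangent p) :
    comps p₀.proj p.proj (connMap cov p ξ)
      = vert (christoffel cov p₀.proj) (extChartAt I.tangent p₀ p) (comps p₀ p ξ) := by
  conv_lhs => rw [exists_eq_hlift_add_vlift cov hp ξ, connMap_add, connMap_hlift, connMap_vlift,
    zero_add, comps_ofComps hp]

end TangentChart

namespace TangentChart

open LocalConnection

variable {E : Type*} [NormedAddCommGroup E] [NormedSpace ℝ E] [FiniteDimensional ℝ E]
  {H : Type*} [TopologicalSpace H] {I : ModelWithCorners ℝ E H} [I.Boundaryless]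
  {M : Type*} [TopologicalSpace M] [ChartedSpace H M] [IsManifold I ∞ M]
  {g : ContMDiffRiemannianMetric I ∞ E (TangentSpace I : M → Type _)}
  {cov : CovariantDerivative I E (TangentSpace I : M → Type _)}

lemma rep_hliftField (p₀ : TangentBundle I M) (X : ∀ x : M, TangentSpace I x) {q : E × E}
    (hq : q.1 ∈ (extChartAt I p₀.proj).target) :
    rep p₀ (hliftField cov X) q
      = lift (christoffel cov p₀.proj) q (rep p₀.proj X q.1) 0 := by
  obtain ⟨hq', hs, hφ⟩ := symm_mem_source p₀ hq
  rw [rep, hliftField, comps_hlift hs, (extChartAt I.tangent p₀).right_inv hq', ← rep_apply hs, hφ]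

lemma rep_vliftField (cov : CovariantDerivative I E (TangentSpace I : M → Type _))
    (p₀ : TangentBundle I M) (X : ∀ x : M, TangentSpace I x) {q : E × E}
    (hq : q.1 ∈ (extChartAt I p₀.proj).target) :
    rep p₀ (vliftField X) q
      = lift (christoffel cov p₀.proj) q 0 (rep p₀.proj X q.1) := by
  obtain ⟨hq', hs, hφ⟩ := symm_mem_source p₀ hq
  rw [rep, vliftField, comps_vlift hs, ← rep_apply hs, hφ, lift]
  simp

/-- The metric `gNat` in the chart at `p₀`. -/
lemma gNat_ofComps (a b c : ℝ) (p₀ : TangentBundle I M) {q : E × E}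
    (hq : q.1 ∈ (extChartAt I p₀.proj).target) (e f : E × E) :
    gNat a b c (fun x u v ↦ g.inner x u v) cov ((extChartAt I.tangent p₀).symm q)
        (ofComps p₀ ((extChartAt I.tangent p₀).symm q) e)
        (ofComps p₀ ((extChartAt I.tangent p₀).symm q) f)
      = liftMetric a b c (metricRep g p₀.proj) (christoffel cov p₀.proj) q e f := by
  obtain ⟨hq', hs, hφ⟩ := symm_mem_source p₀ hq
  have hs' := (extChartAt I.tangent p₀).map_target hq'
  simp only [gNat, inner_eq_metricRep g hs, comps_dproj hs, comps_connMap hs, hφ,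
    (extChartAt I.tangent p₀).right_inv hq', comps_ofComps hs', liftMetric]

variable [CompleteSpace E] {a b c α : ℝ}
  {covT : CovariantDerivative I.tangent (E × E)
    (TangentSpace I.tangent : TangentBundle I M → Type _)}

lemma christoffel_tangent (hcov : IsLeviCivita (fun x u v ↦ g.inner x u v) cov)
    (ha : 0 < a) (hα : α = a * (a + c) - b ^ 2) (hαpos : 0 < α)
    (hcovT : IsLeviCivita (gNat a b c (fun x u v ↦ g.inner x u v) cov) covT)
    (p₀ : TangentBundle I M) {q : E × E} (hq : q.1 ∈ (extChartAt I p₀.proj).target)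
    (ξ η : E × E) :
    christoffel covT p₀ q ξ η
      = liftChristoffel a b c α (christoffel cov p₀.proj) q ξ η := by
  have h := isLeviCivitaOn hcov p₀.proj
  obtain ⟨hq', -, -⟩ := symm_mem_source p₀ hq
  refine h.eq_liftChristoffel ha hα hαpos hq (Γ' := fun ξ η ↦ christoffel covT p₀ q ξ η)
    (fun ξ η ↦ christoffel_symm hcovT.torsion_eq_zero hq' ξ η) (fun ζ ξ η ↦ ?_) ξ η
  have heq : (fun q ↦ gNat a b c (fun x u v ↦ g.inner x u v) cov ((extChartAt I.tangent p₀).symm q)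
      (ofComps p₀ ((extChartAt I.tangent p₀).symm q) ξ)
      (ofComps p₀ ((extChartAt I.tangent p₀).symm q) η)) =ᶠ[𝓝 q]
      fun q ↦ liftMetric a b c (metricRep g p₀.proj) (christoffel cov p₀.proj) q ξ η := by
    filter_upwards [(h.isOpen.preimage continuous_fst).mem_nhds hq] with q' hq'
    exact gNat_ofComps a b c p₀ hq' ξ η
  have hd := (h.fderiv_liftMetric hα hαpos.ne' hq ζ ξ η).1.congr_of_eventuallyEq heq
  have h1 := fderiv_metric hcovT hq' ξ η hd ζ
  rw [heq.fderiv_eq] at h1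
  rw [h1, gNat_ofComps a b c p₀ hq, gNat_ofComps a b c p₀ hq]

lemma curvField_hlift_vlift_hlift (hcov : IsLeviCivita (fun x u v ↦ g.inner x u v) cov)
    (ha : 0 < a) (hα : α = a * (a + c) - b ^ 2) (hαpos : 0 < α)
    (hcovT : IsLeviCivita (gNat a b c (fun x u v ↦ g.inner x u v) cov) covT)
    {X Y Z : ∀ x : M, TangentSpace I x}
    (hX : ContMDiff I I.tangent ∞ fun x ↦ (⟨x, X x⟩ : TangentBundle I M))
    (hY : ContMDiff I I.tangent ∞ fun x ↦ (⟨x, Y x⟩ : TangentBundle I M))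
    (hZ : ContMDiff I I.tangent ∞ fun x ↦ (⟨x, Z x⟩ : TangentBundle I M))
    (p : TangentBundle I M) :
    curvField covT (hliftField cov X) (vliftField Y) (hliftField cov Z) p
      = hlift cov p
          (-(a ^ 2 / (2 * α)) • nablaCurvAt cov (X p.proj) (Y p.proj) p.snd (Z p.proj)
            + (a ^ 3 * b / (4 * α ^ 2)) •
                (curvAt cov (X p.proj) p.snd (curvAt cov (Y p.proj) p.snd (Z p.proj))
                  - curvAt cov (Y p.proj) p.snd (curvAt cov (Z p.proj) p.snd (X p.proj))
                  - curvAt cov (Y p.proj) p.snd (curvAt cov (X p.proj) p.snd (Z p.proj)))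
            + (a * b / (2 * α)) •
                (curvAt cov (X p.proj) (Y p.proj) (Z p.proj)
                  + curvAt cov (Z p.proj) (Y p.proj) (X p.proj)))
        + vlift p
          ((a * b / (2 * α)) • nablaCurvAt cov (X p.proj) (Y p.proj) p.snd (Z p.proj)
            - (a ^ 2 * b ^ 2 / (4 * α ^ 2)) •
                (curvAt cov (X p.proj) p.snd (curvAt cov (Y p.proj) p.snd (Z p.proj))
                  - curvAt cov (Y p.proj) p.snd (curvAt cov (Z p.proj) p.snd (X p.proj))
                  - curvAt cov (Y p.proj) p.snd (curvAt cov (X p.proj) p.snd (Z p.proj)))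
            + (a ^ 2 / (4 * α)) •
                curvAt cov (X p.proj) (curvAt cov (Y p.proj) p.snd (Z p.proj)) p.snd
            - (b ^ 2 / α) • curvAt cov (X p.proj) (Y p.proj) (Z p.proj)
            + (a * (a + c) / (2 * α)) • curvAt cov (X p.proj) (Z p.proj) (Y p.proj)) := by
  have h := isLeviCivitaOn hcov p.proj
  have hz := mem_extChartAt_target (I := I) p.proj
  have hx := mem_extChartAt_source (I := I) p.proj
  have hp := mem_extChartAt_target (I := I.tangent) p
  have hps := mem_extChartAt_source (I := I.tangent) p
  have hΦ := extChartAt_tangent_apply hx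
  have hq : (extChartAt I.tangent p p).1 ∈ (extChartAt I p.proj).target := by
    rw [hΦ]; exact hz
  have hΓ' : ∀ q : E × E, q.1 ∈ (extChartAt I p.proj).target → ∀ ξ η,
      christoffel covT p q ξ η = liftChristoffel a b c α (christoffel cov p.proj) q ξ η :=
    fun q hq ξ η ↦ christoffel_tangent hcov ha hα hαpos hcovT p hq ξ η
  have hX' := contDiffOn_rep hX p.proj
  have hY' := contDiffOn_rep hY p.proj
  have hZ' := contDiffOn_rep hZ p.proj
  have hd : ∀ {X : E → E}, ContDiffOn ℝ ∞ X (extChartAt I p.proj).target → ∀ {q : E × E},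
      q.1 ∈ (extChartAt I p.proj).target → DifferentiableAt ℝ (fun q : E × E ↦ X q.1) q :=
    fun hX q hq ↦ ((hX.contDiffAt (h.isOpen.mem_nhds hq)).differentiableAt
      (by simp)).comp q differentiableAt_fst
  have hn : ∀ {q : E × E}, q.1 ∈ (extChartAt I p.proj).target →
      ∀ᶠ q' : E × E in 𝓝 q, q'.1 ∈ (extChartAt I p.proj).target := fun hq ↦
    (h.isOpen.preimage continuous_fst).mem_nhds hq
  have eh : ∀ (X : ∀ x : M, TangentSpace I x) {q : E × E},
      q.1 ∈ (extChartAt I p.proj).target → rep p (hliftField cov X) =ᶠ[𝓝 q]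
        fun q ↦ lift (christoffel cov p.proj) q (rep p.proj X q.1) 0 := fun X q hq ↦ by
    filter_upwards [hn hq] with q' hq'
    exact rep_hliftField p X hq'
  have ev : rep p (vliftField Y) =ᶠ[𝓝 (extChartAt I.tangent p p)]
      fun q ↦ lift (christoffel cov p.proj) q 0 (rep p.proj Y q.1) := by
    filter_upwards [hn hq] with q' hq'
    exact rep_vliftField cov p Y hq'
  have dh : ∀ {X : ∀ x : M, TangentSpace I x},
      ContDiffOn ℝ ∞ (rep p.proj X) (extChartAt I p.proj).target → ∀ {q : E × E},
      q.1 ∈ (extChartAt I p.proj).target → DifferentiableAt ℝ (rep p (hliftField cov X)) q :=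
    fun {X} hX q hq ↦ (h.differentiableAt_lift hq (hd hX hq)
      (differentiableAt_const 0)).congr_of_eventuallyEq (eh X hq)
  have dv : DifferentiableAt ℝ (rep p (vliftField Y)) (extChartAt I.tangent p p) :=
    (h.differentiableAt_lift hq (differentiableAt_const 0) (hd hY' hq)).congr_of_eventuallyEq ev
  have eYZ : nabla (christoffel covT p) (rep p (vliftField Y)) (rep p (hliftField cov Z))
      =ᶠ[𝓝 (extChartAt I.tangent p p)] nabla (christoffel covT p)
        (fun q ↦ lift (christoffel cov p.proj) q 0 (rep p.proj Y q.1))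
        (fun q ↦ lift (christoffel cov p.proj) q (rep p.proj Z q.1) 0) := by
    filter_upwards [hn hq] with q hq
    exact nabla_congr rfl (rep_vliftField cov p Y hq) (eh Z hq)
  have eXZ : nabla (christoffel covT p) (rep p (hliftField cov X)) (rep p (hliftField cov Z))
      =ᶠ[𝓝 (extChartAt I.tangent p p)] nabla (christoffel covT p)
        (fun q ↦ lift (christoffel cov p.proj) q (rep p.proj X q.1) 0)
        (fun q ↦ lift (christoffel cov p.proj) q (rep p.proj Z q.1) 0) := by
    filter_upwards [hn hq] with q hq
    exact nabla_congr rfl (rep_hliftField p X hq) (eh Z hq)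
  have dYZ := (h.differentiableAt_nabla_vertical_horizontal hΓ' hY' hZ'
    hq).congr_of_eventuallyEq eYZ
  have dXZ := (h.differentiableAt_nabla_horizontal_horizontal hΓ' hX' hZ'
    hq).congr_of_eventuallyEq eXZ
  have hZon : DifferentiableOn ℝ (rep p (hliftField cov Z)) (extChartAt I.tangent p).target := by
    intro q hq
    rw [extChartAt_tangent_target] at hq
    exact (dh hZ' hq.1).differentiableWithinAt
  have key := rep_curvField hcovT.torsion_eq_zero hp (dh hX' hq) dv hZon dYZ dXZ
  have e3 : nabla (christoffel covT p) (fun q ↦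
        nabla (christoffel covT p) (rep p (hliftField cov X)) (rep p (vliftField Y)) q
          - nabla (christoffel covT p) (rep p (vliftField Y)) (rep p (hliftField cov X)) q)
        (rep p (hliftField cov Z)) (extChartAt I.tangent p p)
      = nabla (christoffel covT p) (fun q ↦
        nabla (christoffel covT p)
            (fun q ↦ lift (christoffel cov p.proj) q (rep p.proj X q.1) 0)
            (fun q ↦ lift (christoffel cov p.proj) q 0 (rep p.proj Y q.1)) q
          - nabla (christoffel covT p)
            (fun q ↦ lift (christoffel cov p.proj) q 0 (rep p.proj Y q.1))
            (fun q ↦ lift (christoffel cov p.proj) q (rep p.proj X q.1) 0) q)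
        (fun q ↦ lift (christoffel cov p.proj) q (rep p.proj Z q.1) 0)
        (extChartAt I.tangent p p) := by
    refine nabla_congr rfl ?_ (eh Z hq)
    rw [nabla_congr (X' := fun q ↦ lift (christoffel cov p.proj) q (rep p.proj X q.1) 0) rfl
      (rep_hliftField p X hq) ev,
      nabla_congr (X' := fun q ↦ lift (christoffel cov p.proj) q 0 (rep p.proj Y q.1)) rfl
      (rep_vliftField cov p Y hq) (eh X hq)]
  rw [nabla_congr (X' := fun q ↦ lift (christoffel cov p.proj) q (rep p.proj X q.1) 0) rfl
      (rep_hliftField p X hq) eYZ,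
    nabla_congr (X' := fun q ↦ lift (christoffel cov p.proj) q 0 (rep p.proj Y q.1)) rfl
      (rep_vliftField cov p Y hq) eXZ, e3, rep_apply hps, hΦ,
    h.curv_lift hα hαpos.ne' hΓ' hX' hY' hZ' hz, rep_apply hx, rep_apply hx, rep_apply hx] at key
  apply comps_injective hps
  rw [key, map_add, comps_hlift hx, comps_vlift hx, hΦ]
  simp only [map_add, map_sub, map_smul, curvAt_eq hcov, nablaCurvAt_eq hcov]
  ext
  · simp [lift]
  · simp [lift]; abel

end TangentChart

end

theorem stmt_5 {n : ℕ} (hn : 3 ≤ n)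
    {M : Type*} [TopologicalSpace M] [ChartedSpace (EuclideanSpace ℝ (Fin n)) M]
    [IsManifold (𝓡 n) ∞ M]
    (g : ContMDiffRiemannianMetric (𝓡 n) ∞ (EuclideanSpace ℝ (Fin n))
      (TangentSpace (𝓡 n) : M → Type _))
    (cov : CovariantDerivative (𝓡 n) (EuclideanSpace ℝ (Fin n))
      (TangentSpace (𝓡 n) : M → Type _))
    (hcov : IsLeviCivita (fun x u v ↦ g.inner x u v) cov)
    {a b c α : ℝ} (ha : 0 < a) (hα : α = a * (a + c) - b ^ 2) (hαpos : 0 < α)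
    (covT : CovariantDerivative (𝓡 n).tangent
      (EuclideanSpace ℝ (Fin n) × EuclideanSpace ℝ (Fin n))
      (TangentSpace (𝓡 n).tangent : TangentBundle (𝓡 n) M → Type _))
    (hcovT : IsLeviCivita (gNat a b c (fun x u v ↦ g.inner x u v) cov) covT)
    (X Y Z : ∀ x : M, TangentSpace (𝓡 n) x)
    (hX : ContMDiff (𝓡 n) (𝓡 n).tangent ∞ fun x ↦ (⟨x, X x⟩ : TangentBundle (𝓡 n) M))
    (hY : ContMDiff (𝓡 n) (𝓡 n).tangent ∞ fun x ↦ (⟨x, Y x⟩ : TangentBundle (𝓡 n) M))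
    (hZ : ContMDiff (𝓡 n) (𝓡 n).tangent ∞ fun x ↦ (⟨x, Z x⟩ : TangentBundle (𝓡 n) M))
    (x : M) (t : TangentSpace (𝓡 n) x) :
    curvField covT (hliftField cov X) (vliftField Y) (hliftField cov Z) ⟨x, t⟩
      = hlift cov ⟨x, t⟩
          (-(a ^ 2 / (2 * α)) • nablaCurvAt cov (X x) (Y x) t (Z x)
            + (a ^ 3 * b / (4 * α ^ 2)) •
                (curvAt cov (X x) t (curvAt cov (Y x) t (Z x))
                  - curvAt cov (Y x) t (curvAt cov (Z x) t (X x))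
                  - curvAt cov (Y x) t (curvAt cov (X x) t (Z x)))
            + (a * b / (2 * α)) •
                (curvAt cov (X x) (Y x) (Z x) + curvAt cov (Z x) (Y x) (X x)))
        + vlift ⟨x, t⟩
          ((a * b / (2 * α)) • nablaCurvAt cov (X x) (Y x) t (Z x)
            - (a ^ 2 * b ^ 2 / (4 * α ^ 2)) •
                (curvAt cov (X x) t (curvAt cov (Y x) t (Z x))
                  - curvAt cov (Y x) t (curvAt cov (Z x) t (X x))
                  - curvAt cov (Y x) t (curvAt cov (X x) t (Z x)))
            + (a ^ 2 / (4 * α)) • curvAt cov (X x) (curvAt cov (Y x) t (Z x)) t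
            - (b ^ 2 / α) • curvAt cov (X x) (Y x) (Z x)
            + (a * (a + c) / (2 * α)) • curvAt cov (X x) (Z x) (Y x)) :=
  TangentChart.curvField_hlift_vlift_hlift hcov ha hα hαpos hcovT hX hY hZ ⟨x, t⟩
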